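/- There exist δ₀ > 0 and C > 0, depending only on p, μ, v_±, s and the profile ṽ, such that for every T > 0, every δ ≤ δ₀, and every classical solution (Φ,Ψ) of the integrated perturbation system on ℝ × [0,T] satisfying the a priori smallness assumption with parameter δ, for all t ∈ [0,T]: ∫₀ᵗ ‖Ψ_ξξ(τ)‖² dτ ≤ C ‖(Φ₀,Ψ₀)‖₂². -/

import Mathlib

open MeasureTheory Filter Topology Set

noncomputable section

noncomputable def L2sq (w : ℝ → ℝ) : ℝ := ∫ ξ : ℝ, (w ξ) ^ 2

noncomputable def HkSq (k : ℕ) (w : ℝ → ℝ) : ℝ :=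
  ∑ j ∈ Finset.range (k + 1), L2sq (iteratedDeriv j w)

noncomputable def pairHkSq (k : ℕ) (F G : ℝ → ℝ) : ℝ := HkSq k F + HkSq k G

/-- The nonlinear remainder `G = (g'(v) - g'(ṽ))Φ_ξξ + (g'(v) - g'(ṽ) - g''(ṽ)Φ_ξ)ṽ_ξ`
with `v = ṽ + Φ_ξ`. -/
noncomputable def Gterm (g tv φ : ℝ → ℝ) (ξ : ℝ) : ℝ :=
  (deriv g (tv ξ + deriv φ ξ) - deriv g (tv ξ)) * iteratedDeriv 2 φ ξ +
    (deriv g (tv ξ + deriv φ ξ) - deriv g (tv ξ)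
      - deriv (deriv g) (tv ξ) * deriv φ ξ) * deriv tv ξ

/-- The relative pressure `p(v|ṽ) = p(v) - p(ṽ) - p'(ṽ)(v - ṽ)` with `v = ṽ + Φ_ξ`. -/
noncomputable def prel (p tv φ : ℝ → ℝ) (ξ : ℝ) : ℝ :=
  p (tv ξ + deriv φ ξ) - p (tv ξ) - deriv p (tv ξ) * deriv φ ξ

/-- A classical solution of the integrated perturbation system on `ℝ × [0,T]`:
`C⁴` in `ξ`, `C¹` in `t` with continuous mixed derivatives `∂_t ∂_ξ^j` (`j ≤ 3`),
satisfying both equations pointwise, with square-integrable `ξ`-derivatives up to order 4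
(`L²`-norms continuous in `t`) and derivatives up to order 3 decaying at spatial infinity,
uniformly in `t`. -/
structure IsClassicalSolution (p g tv : ℝ → ℝ) (s T : ℝ) (Φ Ψ : ℝ → ℝ → ℝ) : Prop where
  regΦ : ∀ t ∈ Set.Icc (0:ℝ) T, ContDiff ℝ 4 (Φ t)
  regΨ : ∀ t ∈ Set.Icc (0:ℝ) T, ContDiff ℝ 4 (Ψ t)
  tdiffΦ : ∀ j : ℕ, j ≤ 3 → ∀ t ∈ Set.Icc (0:ℝ) T, ∀ ξ : ℝ,
    DifferentiableAt ℝ (fun τ => iteratedDeriv j (Φ τ) ξ) t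
  tdiffΨ : ∀ j : ℕ, j ≤ 3 → ∀ t ∈ Set.Icc (0:ℝ) T, ∀ ξ : ℝ,
    DifferentiableAt ℝ (fun τ => iteratedDeriv j (Ψ τ) ξ) t
  mixContΦ : ∀ j : ℕ, j ≤ 3 → ContinuousOn
    (fun q : ℝ × ℝ => deriv (fun τ => iteratedDeriv j (Φ τ) q.2) q.1)
    (Set.Icc (0:ℝ) T ×ˢ (Set.univ : Set ℝ))
  mixContΨ : ∀ j : ℕ, j ≤ 3 → ContinuousOn
    (fun q : ℝ × ℝ => deriv (fun τ => iteratedDeriv j (Ψ τ) q.2) q.1)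
    (Set.Icc (0:ℝ) T ×ˢ (Set.univ : Set ℝ))
  spContΦ : ∀ j : ℕ, j ≤ 4 → ContinuousOn
    (fun q : ℝ × ℝ => iteratedDeriv j (Φ q.1) q.2)
    (Set.Icc (0:ℝ) T ×ˢ (Set.univ : Set ℝ))
  spContΨ : ∀ j : ℕ, j ≤ 4 → ContinuousOn
    (fun q : ℝ × ℝ => iteratedDeriv j (Ψ q.1) q.2)
    (Set.Icc (0:ℝ) T ×ˢ (Set.univ : Set ℝ))
  eq1 : ∀ t ∈ Set.Icc (0:ℝ) T, ∀ ξ : ℝ,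
    deriv (fun τ => Φ τ ξ) t - s * deriv (Φ t) ξ - deriv (Ψ t) ξ
        - deriv g (tv ξ) * iteratedDeriv 2 (Φ t) ξ
        - deriv (deriv g) (tv ξ) * deriv tv ξ * deriv (Φ t) ξ
      = Gterm g tv (Φ t) ξ
  eq2 : ∀ t ∈ Set.Icc (0:ℝ) T, ∀ ξ : ℝ,
    deriv (fun τ => Ψ τ ξ) t - s * deriv (Ψ t) ξ + deriv p (tv ξ) * deriv (Φ t) ξ
      = -prel p tv (Φ t) ξ
  sqIntΦ : ∀ j : ℕ, j ≤ 4 → ∀ t ∈ Set.Icc (0:ℝ) T,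
    MeasureTheory.Integrable (fun ξ : ℝ => (iteratedDeriv j (Φ t) ξ) ^ 2)
  sqIntΨ : ∀ j : ℕ, j ≤ 4 → ∀ t ∈ Set.Icc (0:ℝ) T,
    MeasureTheory.Integrable (fun ξ : ℝ => (iteratedDeriv j (Ψ t) ξ) ^ 2)
  l2ContΦ : ∀ j : ℕ, j ≤ 4 →
    ContinuousOn (fun t => L2sq (iteratedDeriv j (Φ t))) (Set.Icc (0:ℝ) T)
  l2ContΨ : ∀ j : ℕ, j ≤ 4 →
    ContinuousOn (fun t => L2sq (iteratedDeriv j (Ψ t))) (Set.Icc (0:ℝ) T)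
  decayΦ : ∀ j : ℕ, j ≤ 3 → ∀ ε > (0:ℝ), ∃ R : ℝ, ∀ t ∈ Set.Icc (0:ℝ) T, ∀ ξ : ℝ,
    R ≤ |ξ| → |iteratedDeriv j (Φ t) ξ| < ε
  decayΨ : ∀ j : ℕ, j ≤ 3 → ∀ ε > (0:ℝ), ∃ R : ℝ, ∀ t ∈ Set.Icc (0:ℝ) T, ∀ ξ : ℝ,
    R ≤ |ξ| → |iteratedDeriv j (Ψ t) ξ| < ε

/-- On a compact subinterval of `(0,∞)` a smooth function is bounded, Lipschitz, and agrees with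
its linearization up to a quadratic error. -/
lemma exists_taylor_bounds {F : ℝ → ℝ} (hF : ContDiffOn ℝ (⊤ : ℕ∞) F (Ioi 0))
    {α β : ℝ} (hα : 0 < α) :
    ∃ L : ℝ, 0 ≤ L ∧ ∀ a ∈ Icc α β, ∀ b ∈ Icc α β, |F a| ≤ L ∧ |F b - F a| ≤ L * |b - a| ∧
      |F b - F a - deriv F a * (b - a)| ≤ L * (b - a) ^ 2 := by
  have hsub : Icc α β ⊆ Ioi 0 := fun z hz => lt_of_lt_of_le hα hz.1
  have hF1 : ContDiffOn ℝ (⊤ : ℕ∞) (deriv F) (Ioi 0) := hF.deriv_of_isOpen isOpen_Ioi le_rfl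
  have hF2 : ContDiffOn ℝ (⊤ : ℕ∞) (deriv (deriv F)) (Ioi 0) :=
    hF1.deriv_of_isOpen isOpen_Ioi le_rfl
  have hd : ∀ {H : ℝ → ℝ}, ContDiffOn ℝ (⊤ : ℕ∞) H (Ioi 0) → ∀ z ∈ Icc α β,
      HasDerivAt H (deriv H z) z := fun hH z hz =>
    ((hH.differentiableOn (by simp)).differentiableAt (Ioi_mem_nhds (hsub hz))).hasDerivAt
  obtain ⟨L0, h0⟩ := isCompact_Icc.exists_bound_of_continuousOn (hF.continuousOn.mono hsub)
  obtain ⟨L1, h1⟩ := isCompact_Icc.exists_bound_of_continuousOn (hF1.continuousOn.mono hsub)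
  obtain ⟨L2, h2⟩ := isCompact_Icc.exists_bound_of_continuousOn (hF2.continuousOn.mono hsub)
  have lip : ∀ a ∈ Icc α β, ∀ b ∈ Icc α β, |deriv F b - deriv F a| ≤ |L2| * |b - a| :=
    fun a ha b hb => (convex_Icc α β).norm_image_sub_le_of_norm_hasDerivWithin_le
      (fun z hz => (hd hF1 z hz).hasDerivWithinAt) (fun z hz => (h2 z hz).trans (le_abs_self _))
      ha hb
  refine ⟨|L0| + |L1| + |L2|, by positivity, fun a ha b hb => ⟨?_, ?_, ?_⟩⟩
  · have := (h0 a ha).trans (le_abs_self _)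
    rw [Real.norm_eq_abs] at this
    linarith [abs_nonneg L1, abs_nonneg L2]
  · have : |F b - F a| ≤ |L1| * |b - a| :=
      (convex_Icc α β).norm_image_sub_le_of_norm_hasDerivWithin_le
        (fun z hz => (hd hF z hz).hasDerivWithinAt)
        (fun z hz => (h1 z hz).trans (le_abs_self _)) ha hb
    refine this.trans (mul_le_mul_of_nonneg_right ?_ (abs_nonneg _))
    linarith [abs_nonneg L0, abs_nonneg L2]
  · have hs : uIcc a b ⊆ Icc α β := uIcc_subset_Icc ha hb
    have : |(F b - deriv F a * b) - (F a - deriv F a * a)| ≤ |L2| * |b - a| * |b - a| := by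
      refine (convex_uIcc a b).norm_image_sub_le_of_norm_hasDerivWithin_le
        (f := fun z => F z - deriv F a * z) (f' := fun z => deriv F z - deriv F a)
        (fun z hz => ?_) (fun z hz => ?_) left_mem_uIcc right_mem_uIcc
      · exact (((hd hF z (hs hz)).sub ((hasDerivAt_id z).const_mul (deriv F a))).congr_deriv
          (by simp)).hasDerivWithinAt
      · refine (lip a ha z (hs hz)).trans (mul_le_mul_of_nonneg_left ?_ (abs_nonneg _))
        exact abs_sub_left_of_mem_uIcc hz
    have e : |L2| * |b - a| * |b - a| = |L2| * (b - a) ^ 2 := by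
      rw [mul_assoc, abs_mul_abs_self]; ring
    have e2 : F b - F a - deriv F a * (b - a) = F b - deriv F a * b - (F a - deriv F a * a) := by
      ring
    rw [e] at this
    rw [e2]
    refine this.trans (mul_le_mul_of_nonneg_right ?_ (sq_nonneg _))
    linarith [abs_nonneg L0, abs_nonneg L1]

/-- The increment `F(v) - F(a)` along the profile `a = tv ξ` with `v = a + y`. -/
noncomputable def incr0 (F tv : ℝ → ℝ) (ξ y : ℝ) : ℝ := F (tv ξ + y) - F (tv ξ)

/-- The `ξ`-derivative of `incr0` when `y` depends on `ξ` with derivative `z`. -/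
noncomputable def incr1 (F tv : ℝ → ℝ) (ξ y z : ℝ) : ℝ :=
  deriv F (tv ξ + y) * (deriv tv ξ + z) - deriv F (tv ξ) * deriv tv ξ

/-- The `ξ`-derivative of `incr1` when `y, z` depend on `ξ` with derivatives `z, u`. -/
noncomputable def incr2 (F tv : ℝ → ℝ) (ξ y z u : ℝ) : ℝ :=
  deriv (deriv F) (tv ξ + y) * (deriv tv ξ + z) ^ 2
    + deriv F (tv ξ + y) * (deriv (deriv tv) ξ + u)
    - deriv (deriv F) (tv ξ) * deriv tv ξ ^ 2 - deriv F (tv ξ) * deriv (deriv tv) ξ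

/-- Bounds for the increments of `F` along the profile, uniform for perturbations `|y| ≤ r`. -/
structure IncrBounds (F tv : ℝ → ℝ) (r M : ℝ) : Prop where
  one_le : 1 ≤ M
  lip0 : ∀ ξ y, |y| ≤ r → |incr0 F tv ξ y| ≤ M * |y|
  tay0 : ∀ ξ y, |y| ≤ r → |incr0 F tv ξ y - deriv F (tv ξ) * y| ≤ M * y ^ 2
  bdd1 : ∀ ξ y, |y| ≤ r → |deriv F (tv ξ + y)| ≤ M
  lip1 : ∀ ξ y, |y| ≤ r → |deriv F (tv ξ + y) - deriv F (tv ξ)| ≤ M * |y|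
  tay1 : ∀ ξ y, |y| ≤ r →
    |deriv F (tv ξ + y) - deriv F (tv ξ) - deriv (deriv F) (tv ξ) * y| ≤ M * y ^ 2
  bdd2 : ∀ ξ, |deriv (deriv F) (tv ξ)| ≤ M
  incr1_le : ∀ ξ y z, |y| ≤ r → |incr1 F tv ξ y z| ≤ M * (|y| + |z|)
  incr2_le : ∀ ξ y z u, |y| ≤ r → |z| ≤ 1 →
    |incr2 F tv ξ y z u - deriv F (tv ξ + y) * u| ≤ M * (|y| + |z|)

lemma IncrBounds.mono {F tv : ℝ → ℝ} {r M M' : ℝ} (h : IncrBounds F tv r M) (hM : M ≤ M') :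
    IncrBounds F tv r M' where
  one_le := h.one_le.trans hM
  lip0 ξ y hy := (h.lip0 ξ y hy).trans (by gcongr)
  tay0 ξ y hy := (h.tay0 ξ y hy).trans (by gcongr)
  bdd1 ξ y hy := (h.bdd1 ξ y hy).trans hM
  lip1 ξ y hy := (h.lip1 ξ y hy).trans (by gcongr)
  tay1 ξ y hy := (h.tay1 ξ y hy).trans (by gcongr)
  bdd2 ξ := (h.bdd2 ξ).trans hM
  incr1_le ξ y z hy := (h.incr1_le ξ y z hy).trans (by gcongr)
  incr2_le ξ y z u hy hz := (h.incr2_le ξ y z u hy hz).trans (by gcongr)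

lemma exists_incrBounds {F tv : ℝ → ℝ} (hF : ContDiffOn ℝ (⊤ : ℕ∞) F (Ioi 0))
    {vp vm B : ℝ} (hvp : 0 < vp) (htv : ∀ ξ, tv ξ ∈ Ioo vp vm)
    (hB1 : ∀ ξ, |deriv tv ξ| ≤ B) (hB2 : ∀ ξ, |deriv (deriv tv) ξ| ≤ B) :
    ∃ M, IncrBounds F tv (vp / 2) M := by
  have hF1 : ContDiffOn ℝ (⊤ : ℕ∞) (deriv F) (Ioi 0) := hF.deriv_of_isOpen isOpen_Ioi le_rfl
  have hF2 : ContDiffOn ℝ (⊤ : ℕ∞) (deriv (deriv F)) (Ioi 0) :=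
    hF1.deriv_of_isOpen isOpen_Ioi le_rfl
  have hα : 0 < vp / 2 := by linarith
  obtain ⟨L0, hL0, h0⟩ := exists_taylor_bounds hF (β := vm + vp / 2) hα
  obtain ⟨L1, hL1, h1⟩ := exists_taylor_bounds hF1 (β := vm + vp / 2) hα
  obtain ⟨L2, hL2, h2⟩ := exists_taylor_bounds hF2 (β := vm + vp / 2) hα
  have hB : 0 ≤ B := (abs_nonneg _).trans (hB1 0)
  have ma : ∀ ξ, tv ξ ∈ Icc (vp / 2) (vm + vp / 2) := fun ξ =>
    ⟨by linarith [(htv ξ).1], by linarith [(htv ξ).2]⟩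
  have mb : ∀ ξ y, |y| ≤ vp / 2 → tv ξ + y ∈ Icc (vp / 2) (vm + vp / 2) := fun ξ y hy =>
    ⟨by linarith [(htv ξ).1, (abs_le.1 hy).1], by linarith [(htv ξ).2, (abs_le.1 hy).2]⟩
  have e : ∀ ξ y : ℝ, tv ξ + y - tv ξ = y := fun ξ y => by ring
  have hl1 : ∀ ξ y, |y| ≤ vp / 2 → |deriv F (tv ξ + y) - deriv F (tv ξ)| ≤ L1 * |y| :=
    fun ξ y hy => by simpa only [e] using (h1 _ (ma ξ) _ (mb ξ y hy)).2.1
  have hl2 : ∀ ξ y, |y| ≤ vp / 2 →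
      |deriv (deriv F) (tv ξ + y) - deriv (deriv F) (tv ξ)| ≤ L2 * |y| :=
    fun ξ y hy => by simpa only [e] using (h2 _ (ma ξ) _ (mb ξ y hy)).2.1
  set M := 1 + L0 + L1 + L2 + L1 * B + L2 * B ^ 2 + L2 * (2 * B + 1) with hMdef
  have hp1 : 0 ≤ L1 * B := by positivity
  have hp2 : 0 ≤ L2 * B ^ 2 := by positivity
  have hp3 : 0 ≤ L2 * (2 * B + 1) := by positivity
  have c0 : L0 ≤ M := by linarith
  have c1 : L1 ≤ M := by linarith
  have c2 : L2 ≤ M := by linarith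
  refine ⟨M, by linarith, fun ξ y hy => ?_, fun ξ y hy => ?_, fun ξ y hy => ?_,
    fun ξ y hy => (hl1 ξ y hy).trans (by gcongr), fun ξ y hy => ?_, fun ξ => ?_,
    fun ξ y z hy => ?_, fun ξ y z u hy hz => ?_⟩
  · have := (h0 _ (ma ξ) _ (mb ξ y hy)).2.1
    rw [e] at this
    exact this.trans (by gcongr)
  · have := (h0 _ (ma ξ) _ (mb ξ y hy)).2.2
    rw [e] at this
    exact this.trans (by gcongr)
  · exact ((h1 _ (mb ξ y hy) _ (ma ξ)).1).trans c1
  · have := (h1 _ (ma ξ) _ (mb ξ y hy)).2.2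
    rw [e] at this
    exact this.trans (by gcongr)
  · exact ((h2 _ (ma ξ) _ (ma ξ)).1).trans c2
  · have : incr1 F tv ξ y z = deriv F (tv ξ + y) * z
        + (deriv F (tv ξ + y) - deriv F (tv ξ)) * deriv tv ξ := by
      unfold incr1; ring
    rw [this]
    calc _ ≤ |deriv F (tv ξ + y)| * |z|
          + |deriv F (tv ξ + y) - deriv F (tv ξ)| * |deriv tv ξ| := by
            rw [← abs_mul, ← abs_mul]; exact abs_add_le _ _
      _ ≤ L1 * |z| + L1 * |y| * B := by
            gcongr
            · exact (h1 _ (mb ξ y hy) _ (ma ξ)).1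
            · exact hl1 ξ y hy
            · exact hB1 ξ
      _ = L1 * |z| + L1 * B * |y| := by ring
      _ ≤ M * |z| + M * |y| := by gcongr; linarith
      _ = _ := by ring
  · have : incr2 F tv ξ y z u - deriv F (tv ξ + y) * u
        = (deriv (deriv F) (tv ξ + y) - deriv (deriv F) (tv ξ)) * deriv tv ξ ^ 2
        + deriv (deriv F) (tv ξ + y) * ((2 * deriv tv ξ + z) * z)
        + (deriv F (tv ξ + y) - deriv F (tv ξ)) * deriv (deriv tv) ξ := by
      unfold incr2; ring
    rw [this]
    have ht : |2 * deriv tv ξ + z| ≤ 2 * B + 1 := by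
      refine (abs_add_le _ _).trans ?_
      rw [abs_mul, abs_two]
      linarith [hB1 ξ]
    calc _ ≤ |deriv (deriv F) (tv ξ + y) - deriv (deriv F) (tv ξ)| * |deriv tv ξ| ^ 2
          + |deriv (deriv F) (tv ξ + y)| * (|2 * deriv tv ξ + z| * |z|)
          + |deriv F (tv ξ + y) - deriv F (tv ξ)| * |deriv (deriv tv) ξ| := by
            rw [← abs_pow, ← abs_mul, ← abs_mul, ← abs_mul, ← abs_mul]; exact abs_add_three _ _ _
      _ ≤ L2 * |y| * B ^ 2 + L2 * ((2 * B + 1) * |z|) + L1 * |y| * B := by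
            gcongr
            · exact hl2 ξ y hy
            · exact hB1 ξ
            · exact (h2 _ (mb ξ y hy) _ (ma ξ)).1
            · exact hl1 ξ y hy
            · exact hB2 ξ
      _ = (L2 * B ^ 2 + L1 * B) * |y| + L2 * (2 * B + 1) * |z| := by ring
      _ ≤ M * |y| + M * |z| := by gcongr <;> linarith
      _ = _ := by ring

lemma hasDerivAt_incr0 {F tv f1 : ℝ → ℝ} {ξ f2 : ℝ}
    (hF : ∀ z > 0, HasDerivAt F (deriv F z) z) (htv : HasDerivAt tv (deriv tv ξ) ξ)
    (hf1 : HasDerivAt f1 f2 ξ) (ha : 0 < tv ξ) (hv : 0 < tv ξ + f1 ξ) :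
    HasDerivAt (fun x => incr0 F tv x (f1 x)) (incr1 F tv ξ (f1 ξ) f2) ξ :=
  ((hF _ hv).comp ξ (htv.add hf1)).sub ((hF _ ha).comp ξ htv)

lemma hasDerivAt_incr1 {F tv f1 f2 : ℝ → ℝ} {ξ f3 : ℝ}
    (hF : ∀ z > 0, HasDerivAt (deriv F) (deriv (deriv F) z) z)
    (htv : HasDerivAt tv (deriv tv ξ) ξ)
    (htv1 : HasDerivAt (deriv tv) (deriv (deriv tv) ξ) ξ)
    (hf1 : HasDerivAt f1 (f2 ξ) ξ) (hf2 : HasDerivAt f2 f3 ξ)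
    (ha : 0 < tv ξ) (hv : 0 < tv ξ + f1 ξ) :
    HasDerivAt (fun x => incr1 F tv x (f1 x) (f2 x)) (incr2 F tv ξ (f1 ξ) (f2 ξ) f3) ξ := by
  have h := (((hF _ hv).comp ξ (htv.add hf1)).mul (htv1.add hf2)).sub
    (((hF _ ha).comp ξ htv).mul htv1)
  refine HasDerivAt.congr_deriv (f' := _) h ?_
  simp only [incr2, Function.comp, Pi.add_apply]
  ring

lemma abs_mul_le_mul {a b A B : ℝ} (ha : |a| ≤ A) (hb : |b| ≤ B) : |a * b| ≤ A * B := by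
  rw [abs_mul]
  exact mul_le_mul ha hb (abs_nonneg _) ((abs_nonneg _).trans ha)

lemma young_le {c : ℝ} (hc : 0 < c) (M u v : ℝ) :
    M * (u * v) ≤ c / 2 * u ^ 2 + M ^ 2 / (2 * c) * v ^ 2 := by
  have : c / 2 * u ^ 2 + M ^ 2 / (2 * c) * v ^ 2 - M * (u * v)
      = (c * u - M * v) ^ 2 / (2 * c) := by field_simp; ring
  have h' : 0 ≤ (c * u - M * v) ^ 2 / (2 * c) := by positivity
  linarith

lemma young_add_le {c : ℝ} (hc : 0 < c) (M u x y : ℝ) :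
    M * (u * (x + y)) ≤ c / 2 * u ^ 2 + M ^ 2 / c * (x ^ 2 + y ^ 2) := by
  have e : M ^ 2 / (2 * c) * (x + y) ^ 2 ≤ M ^ 2 / (2 * c) * (2 * (x ^ 2 + y ^ 2)) := by
    gcongr
    nlinarith [sq_nonneg (x - y)]
  have e3 : M ^ 2 / (2 * c) * (2 * (x ^ 2 + y ^ 2)) = M ^ 2 / c * (x ^ 2 + y ^ 2) := by
    field_simp
  linarith [young_le hc M u (x + y)]

/-- Weights for the hierarchy of energy estimates: the losses at each level are absorbed by the
dissipation of the lower levels. -/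
lemma exists_energy_weights {c M : ℝ} (hc : 0 < c) (hM : 1 ≤ M) :
    ∃ A0 A1 A2 d0 : ℝ, 0 < A0 ∧ 1 ≤ A1 ∧ 1 ≤ c * A2 ∧ 0 < d0 ∧
      ∀ d, 0 ≤ d → d ≤ d0 → ∀ x y z h X0 X1 X2 X3 : ℝ,
        X0 ≤ -c * x ^ 2 + M * d * x ^ 2 →
        X1 ≤ -c * y ^ 2 + M * (x * y) + M * x ^ 2 →
        X2 ≤ -c * z ^ 2 + M * (z * (x + y)) + M * (h * (x + y)) + M * d * (h * z) →
        X3 ≤ -h ^ 2 + M * (h * (x + y + z)) + M * (x * (x + y + z)) →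
        0 ≤ h → 0 ≤ z →
        A0 * X0 + A1 * X1 + A2 * X2 + X3 ≤ -h ^ 2 / 2 := by
  have hM0 : 0 < M := by linarith
  obtain ⟨A2, hA2⟩ : ∃ A2 : ℝ, A2 * c = 16 * M ^ 2 + 3 := ⟨_, div_mul_cancel₀ _ hc.ne'⟩
  have hA2p : 0 < A2 := pos_of_mul_pos_left (by rw [hA2]; positivity) hc.le
  obtain ⟨K, hK⟩ : ∃ K, K = (M * (1 + A2)) ^ 2 / (1 / 2) + A2 * (M ^ 2 / c) + M := ⟨_, rfl⟩
  have hKp : 0 < K := by rw [hK]; positivity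
  obtain ⟨A1, hA1⟩ : ∃ A1 : ℝ, A1 * c = 2 * K + c := ⟨_, div_mul_cancel₀ _ hc.ne'⟩
  have hA1p : 1 ≤ A1 := by
    by_contra! h
    nlinarith
  have hA1pos : 0 < A1 := by linarith
  obtain ⟨A0, hA0⟩ : ∃ A0 : ℝ, A0 * c = 2 * (A1 * M + A1 * (M ^ 2 / (2 * c)) + K + M ^ 2 + M) :=
    ⟨_, div_mul_cancel₀ _ hc.ne'⟩
  have hA0p : 0 < A0 := pos_of_mul_pos_left (by rw [hA0]; positivity) hc.le
  refine ⟨A0, A1, A2, min (c / (2 * M)) (1 / A2), hA0p, hA1p, by nlinarith, by positivity, ?_⟩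
  intro d hd hd0 x y z h X0 X1 X2 X3 h0 h1 h2 h3 hh hz
  have d1 : M * d ≤ c / 2 := by
    have := hd0.trans (min_le_left _ _)
    rw [le_div_iff₀ (by positivity)] at this
    linarith
  have d2 : A2 * d ≤ 1 := by
    have := hd0.trans (min_le_right _ _)
    rw [le_div_iff₀ hA2p] at this
    linarith
  have i0 : A0 * X0 ≤ -(A0 * c) / 2 * x ^ 2 := by
    have e : M * d * x ^ 2 ≤ c / 2 * x ^ 2 := by gcongr
    have : A0 * X0 ≤ A0 * (-c / 2 * x ^ 2) := by
      gcongr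
      linarith
    linarith
  have i1 : A1 * X1 ≤ -(A1 * c) * y ^ 2 + A1 * (M * (x * y)) + A1 * M * x ^ 2 := by
    have : A1 * X1 ≤ A1 * (-c * y ^ 2 + M * (x * y) + M * x ^ 2) := by gcongr
    linarith
  have i2 : A2 * X2 ≤ -(A2 * c) * z ^ 2 + A2 * (M * (z * (x + y))) + A2 * M * (h * (x + y))
      + M * (h * z) := by
    have e1 : A2 * X2 ≤ A2 * (-c * z ^ 2 + M * (z * (x + y)) + M * (h * (x + y))
        + M * d * (h * z)) := by gcongr
    have e2 : (A2 * d) * (M * (h * z)) ≤ 1 * (M * (h * z)) := by gcongr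
    linarith
  have j1 : 2 * M * (h * z) ≤ h ^ 2 / 8 + 8 * M ^ 2 * z ^ 2 := by
    refine (young_le (c := 1 / 4) (by norm_num) (2 * M) h z).trans (le_of_eq ?_)
    ring
  have j2 := young_add_le (c := 1 / 2) (by norm_num) (M * (1 + A2)) h x y
  have j3 : A2 * (M * (z * (x + y)))
      ≤ (A2 * c) / 2 * z ^ 2 + A2 * (M ^ 2 / c) * (x ^ 2 + y ^ 2) := by
    linarith [mul_le_mul_of_nonneg_left (young_add_le hc M z x y) hA2p.le]
  have j4 : A1 * (M * (x * y)) ≤ (A1 * c) / 2 * y ^ 2 + A1 * (M ^ 2 / (2 * c)) * x ^ 2 := by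
    have := mul_le_mul_of_nonneg_left (young_le hc M y x) hA1pos.le
    rw [mul_comm x y]
    linarith
  have j5 : M * (x * z) ≤ z ^ 2 + M ^ 2 * x ^ 2 := by
    nlinarith [sq_nonneg (M * x - z), sq_nonneg z, sq_nonneg (M * x)]
  have j6 : M * (x * y) ≤ M * x ^ 2 / 2 + M * y ^ 2 / 2 := by
    have := mul_nonneg hM0.le (sq_nonneg (x - y))
    linarith
  have hKx : K * (x ^ 2 + y ^ 2) = (M * (1 + A2)) ^ 2 / (1 / 2) * (x ^ 2 + y ^ 2)
      + A2 * (M ^ 2 / c) * (x ^ 2 + y ^ 2) + M * (x ^ 2 + y ^ 2) := by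
    rw [hK]; ring
  rw [hA0] at i0
  rw [hA1] at j4 i1
  rw [hA2] at j3 i2
  have p1 : 0 ≤ M * x ^ 2 := by positivity
  have p2 : 0 ≤ M ^ 2 * x ^ 2 := by positivity
  have p3 : 0 ≤ c * y ^ 2 := by positivity
  have p4 : 0 ≤ z ^ 2 := sq_nonneg z
  have p5 : 0 ≤ h ^ 2 := sq_nonneg h
  have p6 : 0 ≤ M * y ^ 2 := by positivity
  generalize (M * (1 + A2)) ^ 2 / (1 / 2) = B1 at *
  generalize M ^ 2 / c = B2 at *
  generalize M ^ 2 / (2 * c) = B3 at *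
  clear hK hA2 hA1 hA0 h0 h1 h2 hKp hA0p hA1p hA1pos d1 d2 hd hd0
  linarith

lemma zeroth_level_le {c M d s a1 p2 w f1 h0 P1 Q : ℝ} (hM : 1 ≤ M)
    (hs : s ≤ 0) (ha1 : a1 ≤ 0) (hp2 : 0 ≤ p2) (hw : |w| ≤ M)
    (hP : |P1| ≤ M * f1 ^ 2) (hQ : c * f1 ^ 2 ≤ Q * f1) (hh : |h0| ≤ d) :
    -w * h0 * P1 - s * (w ^ 2 * p2 * a1) * h0 ^ 2 / 2 - f1 * Q
      ≤ -c * f1 ^ 2 + 2 * M ^ 3 * d * f1 ^ 2 := by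
  have h1 : |w * h0 * P1| ≤ M * d * (M * f1 ^ 2) := abs_mul_le_mul (abs_mul_le_mul hw hh) hP
  have h2 : 0 ≤ s * a1 * (w ^ 2 * p2 * h0 ^ 2) :=
    mul_nonneg (mul_nonneg_of_nonpos_of_nonpos hs ha1) (by positivity)
  have hd : 0 ≤ d := (abs_nonneg _).trans hh
  have h3 : M * d * (M * f1 ^ 2) ≤ 2 * M ^ 3 * d * f1 ^ 2 := by
    have : M ^ 2 * (d * f1 ^ 2) ≤ 2 * M ^ 3 * (d * f1 ^ 2) := by
      gcongr
      nlinarith [sq_nonneg M]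
    linarith
  have := neg_abs_le (w * h0 * P1)
  linarith

lemma first_level_le {c M d s a1 p2 w f1 f2 h1 G E P1 : ℝ} (hM : 1 ≤ M) (hd : d ≤ 1)
    (hs : 1 ≤ M * -s) (ha1 : a1 ≤ 0) (ha1M : |a1| ≤ M) (hp2 : 0 ≤ p2) (hp2M : |p2| ≤ M)
    (hw : |w| ≤ M) (hG : c ≤ G) (hE : |E| ≤ M * |f1|) (hP1 : |P1| ≤ M * |f1|)
    (hP1' : |P1 - p2 * f1| ≤ M * f1 ^ 2) (hh : |h1| ≤ d) :
    -s * (w ^ 2 * p2 * a1) * h1 ^ 2 / 2 - f2 * (G * f2 + E * a1) - w * h1 * P1 * (a1 + f2)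
      ≤ -c * f2 ^ 2 + 2 * M ^ 3 * (|f1| * |f2|) + 2 * M ^ 3 * |f1| ^ 2 := by
  have hM0 : 0 < M := by linarith
  have hsp : 0 < -s := by
    by_contra! h
    nlinarith
  have young : (w * h1) * f1 - -s * (w * h1) ^ 2 / 2 ≤ M * f1 ^ 2 / 2 := by
    have : 0 ≤ -s * (M * f1 ^ 2 + -s * (w * h1) ^ 2 - 2 * ((w * h1) * f1)) := by
      nlinarith [sq_nonneg (f1 - -s * (w * h1)), sq_nonneg f1]
    have := nonneg_of_mul_nonneg_right this hsp
    linarith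
  have b0 : 0 ≤ -a1 * p2 := mul_nonneg (by linarith) hp2
  have b1 : -a1 * p2 ≤ M * M :=
    mul_le_mul ((neg_le_abs a1).trans ha1M) ((le_abs_self _).trans hp2M) hp2 hM0.le
  have t1 : -a1 * p2 * ((w * h1) * f1 - -s * (w * h1) ^ 2 / 2) ≤ M * M * (M * f1 ^ 2 / 2) :=
    (mul_le_mul_of_nonneg_left young b0).trans (by gcongr)
  have hd1 : |h1| ≤ 1 := hh.trans hd
  have t2 : |f2 * (E * a1)| ≤ |f2| * (M * |f1| * M) :=
    abs_mul_le_mul le_rfl (abs_mul_le_mul hE ha1M)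
  have t3 : |w * h1 * (P1 - p2 * f1) * a1| ≤ M * 1 * (M * f1 ^ 2) * M :=
    abs_mul_le_mul (abs_mul_le_mul (abs_mul_le_mul hw hd1) hP1') ha1M
  have t4 : |w * h1 * P1 * f2| ≤ M * 1 * (M * |f1|) * |f2| :=
    abs_mul_le_mul (abs_mul_le_mul (abs_mul_le_mul hw hd1) hP1) le_rfl
  have t5 : c * f2 ^ 2 ≤ G * f2 ^ 2 := by gcongr
  have t6 : 2 * M ^ 2 * (|f1| * |f2|) ≤ 2 * M ^ 3 * (|f1| * |f2|) := by
    have : M ^ 2 ≤ M ^ 3 := pow_le_pow_right₀ hM (by norm_num)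
    gcongr
  have t7 : 0 ≤ M ^ 3 * f1 ^ 2 := by positivity
  rw [sq_abs]
  have e : -s * (w ^ 2 * p2 * a1) * h1 ^ 2 / 2 - f2 * (G * f2 + E * a1) - w * h1 * P1 * (a1 + f2)
      = -a1 * p2 * ((w * h1) * f1 - -s * (w * h1) ^ 2 / 2) - G * f2 ^ 2 - f2 * (E * a1)
        - w * h1 * (P1 - p2 * f1) * a1 - w * h1 * P1 * f2 := by ring
  rw [e]
  linarith [neg_abs_le (f2 * (E * a1)), neg_abs_le (w * h1 * (P1 - p2 * f1) * a1),
    neg_abs_le (w * h1 * P1 * f2)]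

lemma second_level_le {c M d s a1 p2 w f1 f2 f3 h2 G N2 p1v P1 P2 : ℝ} (hM : 1 ≤ M)
    (hs : s ≤ 0) (ha1 : a1 ≤ 0) (hp2 : 0 ≤ p2) (hw : |w| ≤ M) (hG : c ≤ G)
    (hN : |N2 - G * f3| ≤ M * (|f1| + |f2|)) (hP2 : |P2 - p1v * f3| ≤ M * (|f1| + |f2|))
    (hwp : w * (p1v - P1) = -1) (hP1 : |P1| ≤ M * |f1|) (hf1 : |f1| ≤ d) :
    -f3 * (h2 + N2) - w * h2 * P2 - s * (w ^ 2 * p2 * a1) * h2 ^ 2 / 2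
      ≤ -c * |f3| ^ 2 + 2 * M ^ 3 * (|f3| * (|f1| + |f2|)) + 2 * M ^ 3 * (|h2| * (|f1| + |f2|))
        + 2 * M ^ 3 * d * (|h2| * |f3|) := by
  have hM0 : 0 < M := by linarith
  have hd : 0 ≤ d := (abs_nonneg _).trans hf1
  have t0 : 0 ≤ s * a1 * (w ^ 2 * p2 * h2 ^ 2) :=
    mul_nonneg (mul_nonneg_of_nonpos_of_nonpos hs ha1) (by positivity)
  have t1 : |f3 * (N2 - G * f3)| ≤ |f3| * (M * (|f1| + |f2|)) := abs_mul_le_mul le_rfl hN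
  have t2 : |w * h2 * (P2 - p1v * f3)| ≤ M * |h2| * (M * (|f1| + |f2|)) :=
    abs_mul_le_mul (abs_mul_le_mul hw le_rfl) hP2
  have t3 : |w * h2 * f3 * P1| ≤ M * |h2| * |f3| * (M * d) :=
    abs_mul_le_mul (abs_mul_le_mul (abs_mul_le_mul hw le_rfl) le_rfl) (hP1.trans (by gcongr))
  have t4 : c * f3 ^ 2 ≤ G * f3 ^ 2 := by gcongr
  have m1 : M ≤ 2 * M ^ 3 := by nlinarith [mul_pos hM0 hM0, mul_self_nonneg (M - 1)]
  have m2 : M ^ 2 ≤ 2 * M ^ 3 := by nlinarith [mul_pos hM0 hM0]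
  have u1 : M * (|f3| * (|f1| + |f2|)) ≤ 2 * M ^ 3 * (|f3| * (|f1| + |f2|)) := by gcongr
  have u2 : M ^ 2 * (|h2| * (|f1| + |f2|)) ≤ 2 * M ^ 3 * (|h2| * (|f1| + |f2|)) := by gcongr
  have u3 : M ^ 2 * (d * (|h2| * |f3|)) ≤ 2 * M ^ 3 * (d * (|h2| * |f3|)) := by gcongr
  have e : -f3 * (h2 + N2) - w * h2 * P2 - s * (w ^ 2 * p2 * a1) * h2 ^ 2 / 2
      = -G * f3 ^ 2 - f3 * (N2 - G * f3) - w * h2 * (P2 - p1v * f3) - w * h2 * f3 * P1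
        - s * a1 * (w ^ 2 * p2 * h2 ^ 2) / 2 := by
    linear_combination (-h2 * f3) * hwp
  rw [e, sq_abs]
  linarith [neg_abs_le (f3 * (N2 - G * f3)), neg_abs_le (w * h2 * (P2 - p1v * f3)),
    neg_abs_le (w * h2 * f3 * P1)]

lemma cross_level_le {M f1 f2 f3 h2 G N2 p1v P2 : ℝ} (hM : 1 ≤ M) (hG : |G| ≤ M) (hp : |p1v| ≤ M)
    (hN : |N2 - G * f3| ≤ M * (|f1| + |f2|)) (hP2 : |P2 - p1v * f3| ≤ M * (|f1| + |f2|)) :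
    -h2 ^ 2 - h2 * N2 + f1 * P2
      ≤ -|h2| ^ 2 + 2 * M ^ 3 * (|h2| * (|f1| + |f2| + |f3|))
        + 2 * M ^ 3 * (|f1| * (|f1| + |f2| + |f3|)) := by
  have hM0 : 0 < M := by linarith
  have aux : ∀ {A B : ℝ}, |A| ≤ M → |B - A * f3| ≤ M * (|f1| + |f2|) →
      |B| ≤ M * (|f1| + |f2| + |f3|) := by
    intro A B hA hB
    have h1 : |A * f3| ≤ M * |f3| := abs_mul_le_mul hA le_rfl
    have h2 : |B| ≤ |B - A * f3| + |A * f3| := by simpa using abs_add_le (B - A * f3) (A * f3)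
    linarith
  have t1 : |h2 * N2| ≤ |h2| * (M * (|f1| + |f2| + |f3|)) := abs_mul_le_mul le_rfl (aux hG hN)
  have t2 : |f1 * P2| ≤ |f1| * (M * (|f1| + |f2| + |f3|)) := abs_mul_le_mul le_rfl (aux hp hP2)
  have m1 : M ≤ 2 * M ^ 3 := by nlinarith [mul_pos hM0 hM0, mul_self_nonneg (M - 1)]
  have u1 : M * (|h2| * (|f1| + |f2| + |f3|)) ≤ 2 * M ^ 3 * (|h2| * (|f1| + |f2| + |f3|)) := by
    gcongr
  have u2 : M * (|f1| * (|f1| + |f2| + |f3|)) ≤ 2 * M ^ 3 * (|f1| * (|f1| + |f2| + |f3|)) := by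
    gcongr
  rw [sq_abs]
  linarith [neg_abs_le (h2 * N2), le_abs_self (f1 * P2)]

/-- The weight `-1 / p'(ṽ)` symmetrizing the system. -/
noncomputable def symWeight (p tv : ℝ → ℝ) (ξ : ℝ) : ℝ := -(deriv p (tv ξ))⁻¹

/-- Uniform bounds on all coefficients of the perturbation system, for perturbations of the
profile of size at most `r`. -/
structure CoeffBounds (p g tv : ℝ → ℝ) (s c M r : ℝ) : Prop where
  c_pos : 0 < c
  r_pos : 0 < r
  one_le_mul_neg_s : 1 ≤ M * -s
  abs_s_le : |s| ≤ M
  r_lt : ∀ ξ, r < tv ξ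
  hasDerivAt_p : ∀ z > 0, HasDerivAt p (deriv p z) z
  hasDerivAt_p1 : ∀ z > 0, HasDerivAt (deriv p) (deriv (deriv p) z) z
  hasDerivAt_g : ∀ z > 0, HasDerivAt g (deriv g z) z
  hasDerivAt_g1 : ∀ z > 0, HasDerivAt (deriv g) (deriv (deriv g) z) z
  hasDerivAt_tv : ∀ ξ, HasDerivAt tv (deriv tv ξ) ξ
  hasDerivAt_tv1 : ∀ ξ, HasDerivAt (deriv tv) (deriv (deriv tv) ξ) ξ
  tv1_nonpos : ∀ ξ, deriv tv ξ ≤ 0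
  abs_tv1_le : ∀ ξ, |deriv tv ξ| ≤ M
  p1_ne : ∀ ξ, deriv p (tv ξ) ≠ 0
  p2_nonneg : ∀ ξ, 0 ≤ deriv (deriv p) (tv ξ)
  le_weight : ∀ ξ, c ≤ symWeight p tv ξ
  weight_le : ∀ ξ, symWeight p tv ξ ≤ M
  incr_p : IncrBounds p tv r M
  incr_g : IncrBounds g tv r M
  le_g1 : ∀ ξ y, |y| ≤ r → c ≤ deriv g (tv ξ + y)
  g_mono : ∀ ξ y, |y| ≤ r → c * y ^ 2 ≤ incr0 g tv ξ y * y

namespace CoeffBounds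

variable {p g tv : ℝ → ℝ} {s c M r : ℝ}

lemma weight_pos (hB : CoeffBounds p g tv s c M r) (ξ : ℝ) : 0 < symWeight p tv ξ :=
  hB.c_pos.trans_le (hB.le_weight ξ)

lemma abs_weight_le (hB : CoeffBounds p g tv s c M r) (ξ : ℝ) : |symWeight p tv ξ| ≤ M := by
  rw [abs_of_pos (hB.weight_pos ξ)]
  exact hB.weight_le ξ

lemma weight_mul (hB : CoeffBounds p g tv s c M r) (ξ : ℝ) :
    symWeight p tv ξ * deriv p (tv ξ) = -1 := by
  have := hB.p1_ne ξ
  unfold symWeight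
  field_simp

lemma tv_pos (hB : CoeffBounds p g tv s c M r) (ξ : ℝ) : 0 < tv ξ :=
  hB.r_pos.trans (hB.r_lt ξ)

lemma tv_add_pos (hB : CoeffBounds p g tv s c M r) (ξ : ℝ) {y : ℝ} (hy : |y| ≤ r) :
    0 < tv ξ + y := by
  linarith [hB.r_lt ξ, neg_abs_le y]

lemma hasDerivAt_weight (hB : CoeffBounds p g tv s c M r) (ξ : ℝ) :
    HasDerivAt (symWeight p tv)
      (symWeight p tv ξ ^ 2 * deriv (deriv p) (tv ξ) * deriv tv ξ) ξ := by
  have h := ((((hB.hasDerivAt_p1 _ (hB.tv_pos ξ)).comp ξ (hB.hasDerivAt_tv ξ))).inv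
    (hB.p1_ne ξ)).neg
  refine HasDerivAt.congr_deriv (f' := _) h ?_
  simp only [symWeight, Function.comp]
  have := hB.p1_ne ξ
  field_simp

end CoeffBounds

/-- The energy density: weighted quadratic energies of the first three orders plus a cross term
producing the dissipation of `Ψ_ξξ`. -/
noncomputable def energyDensity (A0 A1 A2 w f0 f1 f2 h0 h1 h2 : ℝ) : ℝ :=
  A0 / 2 * (f0 ^ 2 + w * h0 ^ 2) + A1 / 2 * (f1 ^ 2 + w * h1 ^ 2)
    + A2 / 2 * (f2 ^ 2 + w * h2 ^ 2) - f1 * h2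

/-- The time derivative of `energyDensity`, where `kj`, `mj` are the time derivatives of
`fj`, `hj`. -/
def energyRate (A0 A1 A2 w f0 f1 f2 h0 h1 h2 k0 k1 k2 m0 m1 m2 : ℝ) : ℝ :=
  A0 * (f0 * k0 + w * (h0 * m0)) + A1 * (f1 * k1 + w * (h1 * m1))
    + A2 * (f2 * k2 + w * (h2 * m2)) - (k1 * h2 + f1 * m2)

/-- The spatial flux of the energy. -/
noncomputable def energyFlux (A0 A1 A2 s w f0 f1 f2 h0 h1 h2 Q N k1 : ℝ) : ℝ :=
  A0 * (s / 2 * (f0 ^ 2 + w * h0 ^ 2) + f0 * h0 + f0 * Q)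
    + A1 * (s / 2 * (f1 ^ 2 + w * h1 ^ 2) + f1 * h1 + f1 * N)
    + A2 * (f2 * k1 - s / 2 * f2 ^ 2 + s / 2 * (w * h2 ^ 2)) - s * (f1 * h2)

lemma energyDensity_nonneg {A0 A1 A2 c w f0 f1 f2 h0 h1 h2 : ℝ} (hA0 : 0 < A0) (hA1 : 1 ≤ A1)
    (hc : 0 < c) (hA2 : 1 ≤ c * A2) (hw : c ≤ w) :
    0 ≤ energyDensity A0 A1 A2 w f0 f1 f2 h0 h1 h2 := by
  have hw0 : 0 < w := hc.trans_le hw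
  have hA2p : 0 < A2 := pos_of_mul_pos_right (by linarith) hc.le
  have e1 : 1 * h2 ^ 2 ≤ (w * A2) * h2 ^ 2 := by
    gcongr
    nlinarith
  have e2 : 1 * f1 ^ 2 ≤ A1 * f1 ^ 2 := by gcongr
  have e3 : 0 ≤ A0 / 2 * (f0 ^ 2 + w * h0 ^ 2) := by positivity
  have e4 : 0 ≤ A1 * (w * h1 ^ 2) := by positivity
  have e5 : 0 ≤ A2 * f2 ^ 2 := by positivity
  unfold energyDensity
  nlinarith [sq_nonneg (f1 - h2)]

lemma energyDensity_le {A0 A1 A2 M w f0 f1 f2 h0 h1 h2 : ℝ} (hA0 : 0 < A0) (hA1 : 0 < A1)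
    (hA2 : 0 < A2) (hM : 1 ≤ M) (hw : w ≤ M) :
    energyDensity A0 A1 A2 w f0 f1 f2 h0 h1 h2
      ≤ (A0 + A1 + A2 + 1) * M
        * (f0 ^ 2 + f1 ^ 2 + f2 ^ 2 + h0 ^ 2 + h1 ^ 2 + h2 ^ 2) := by
  have aux : ∀ {A f h : ℝ}, 0 < A →
      A / 2 * (f ^ 2 + w * h ^ 2) ≤ A * (M * (f ^ 2 + h ^ 2)) := by
    intro A f h hA
    have h1 : w * h ^ 2 ≤ M * h ^ 2 := by gcongr
    have h2 : 1 * f ^ 2 ≤ M * f ^ 2 := by gcongr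
    have h3 : A / 2 * (f ^ 2 + w * h ^ 2) ≤ A / 2 * (M * f ^ 2 + M * h ^ 2) := by
      gcongr
      linarith
    have h4 : 0 ≤ A * (M * f ^ 2 + M * h ^ 2) := by positivity
    linarith
  have hc : -(f1 * h2) ≤ M * (f1 ^ 2 + h2 ^ 2) := by
    have : 1 * (f1 ^ 2 + h2 ^ 2) ≤ M * (f1 ^ 2 + h2 ^ 2) := by gcongr
    nlinarith [sq_nonneg (f1 + h2), sq_nonneg f1, sq_nonneg h2]
  set S := f0 ^ 2 + f1 ^ 2 + f2 ^ 2 + h0 ^ 2 + h1 ^ 2 + h2 ^ 2 with hS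
  have up : ∀ {A u : ℝ}, 0 < A → u ≤ S → A * (M * u) ≤ A * (M * S) := by
    intro A u hA hu
    gcongr
  have s0 : f0 ^ 2 + h0 ^ 2 ≤ S := by nlinarith
  have s1 : f1 ^ 2 + h1 ^ 2 ≤ S := by nlinarith
  have s2 : f2 ^ 2 + h2 ^ 2 ≤ S := by nlinarith
  have s3 : f1 ^ 2 + h2 ^ 2 ≤ S := by nlinarith
  unfold energyDensity
  linarith [aux (f := f0) (h := h0) hA0, aux (f := f1) (h := h1) hA1,
    aux (f := f2) (h := h2) hA2, up hA0 s0, up hA1 s1, up hA2 s2, up one_pos s3]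

/-- A time slice of a solution: `fj`, `hj` are the spatial derivatives of `Φ`, `Ψ`, and `kj`, `mj`
are their time derivatives. -/
structure IsSlice (p g tv : ℝ → ℝ) (s : ℝ)
    (f0 f1 f2 f3 h0 h1 h2 h3 k0 k1 k2 m0 m1 m2 : ℝ → ℝ) : Prop where
  df0 : ∀ ξ, HasDerivAt f0 (f1 ξ) ξ
  df1 : ∀ ξ, HasDerivAt f1 (f2 ξ) ξ
  df2 : ∀ ξ, HasDerivAt f2 (f3 ξ) ξ
  dh0 : ∀ ξ, HasDerivAt h0 (h1 ξ) ξ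
  dh1 : ∀ ξ, HasDerivAt h1 (h2 ξ) ξ
  dh2 : ∀ ξ, HasDerivAt h2 (h3 ξ) ξ
  dk0 : ∀ ξ, HasDerivAt k0 (k1 ξ) ξ
  dk1 : ∀ ξ, HasDerivAt k1 (k2 ξ) ξ
  dm0 : ∀ ξ, HasDerivAt m0 (m1 ξ) ξ
  dm1 : ∀ ξ, HasDerivAt m1 (m2 ξ) ξ
  eq_k0 : ∀ ξ, k0 ξ = s * f1 ξ + h1 ξ + incr1 g tv ξ (f1 ξ) (f2 ξ)
  eq_m0 : ∀ ξ, m0 ξ = s * h1 ξ - incr0 p tv ξ (f1 ξ)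

namespace IsSlice

variable {p g tv : ℝ → ℝ} {s c M r : ℝ} {f0 f1 f2 f3 h0 h1 h2 h3 k0 k1 k2 m0 m1 m2 : ℝ → ℝ}

lemma eq_k1 (hS : IsSlice p g tv s f0 f1 f2 f3 h0 h1 h2 h3 k0 k1 k2 m0 m1 m2)
    (hB : CoeffBounds p g tv s c M r) (hr : ∀ ξ, |f1 ξ| ≤ r) (ξ : ℝ) :
    k1 ξ = s * f2 ξ + h2 ξ + incr2 g tv ξ (f1 ξ) (f2 ξ) (f3 ξ) := by
  have h := (((hS.df1 ξ).const_mul s).add (hS.dh1 ξ)).add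
    (hasDerivAt_incr1 hB.hasDerivAt_g1 (hB.hasDerivAt_tv ξ) (hB.hasDerivAt_tv1 ξ) (hS.df1 ξ)
      (hS.df2 ξ) (hB.tv_pos ξ) (hB.tv_add_pos ξ (hr ξ)))
  have e : k0 = _ := funext hS.eq_k0
  exact (e ▸ hS.dk0 ξ).unique h

lemma eq_m1 (hS : IsSlice p g tv s f0 f1 f2 f3 h0 h1 h2 h3 k0 k1 k2 m0 m1 m2)
    (hB : CoeffBounds p g tv s c M r) (hr : ∀ ξ, |f1 ξ| ≤ r) (ξ : ℝ) :
    m1 ξ = s * h2 ξ - incr1 p tv ξ (f1 ξ) (f2 ξ) := by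
  have h := ((hS.dh1 ξ).const_mul s).sub
    (hasDerivAt_incr0 hB.hasDerivAt_p (hB.hasDerivAt_tv ξ) (hS.df1 ξ)
      (hB.tv_pos ξ) (hB.tv_add_pos ξ (hr ξ)))
  have e : m0 = _ := funext hS.eq_m0
  exact (e ▸ hS.dm0 ξ).unique h

lemma eq_m2 (hS : IsSlice p g tv s f0 f1 f2 f3 h0 h1 h2 h3 k0 k1 k2 m0 m1 m2)
    (hB : CoeffBounds p g tv s c M r) (hr : ∀ ξ, |f1 ξ| ≤ r) (ξ : ℝ) :
    m2 ξ = s * h3 ξ - incr2 p tv ξ (f1 ξ) (f2 ξ) (f3 ξ) := by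
  have h := ((hS.dh2 ξ).const_mul s).sub
    (hasDerivAt_incr1 hB.hasDerivAt_p1 (hB.hasDerivAt_tv ξ) (hB.hasDerivAt_tv1 ξ) (hS.df1 ξ)
      (hS.df2 ξ) (hB.tv_pos ξ) (hB.tv_add_pos ξ (hr ξ)))
  have e : m1 = _ := funext (hS.eq_m1 hB hr)
  exact (e ▸ hS.dm1 ξ).unique h

lemma hasDerivAt_energyFlux (hS : IsSlice p g tv s f0 f1 f2 f3 h0 h1 h2 h3 k0 k1 k2 m0 m1 m2)
    (hB : CoeffBounds p g tv s c M r) (hr : ∀ ξ, |f1 ξ| ≤ r) (A0 A1 A2 ξ : ℝ) :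
    HasDerivAt (fun x => energyFlux A0 A1 A2 s (symWeight p tv x) (f0 x) (f1 x) (f2 x)
        (h0 x) (h1 x) (h2 x) (incr0 g tv x (f1 x)) (incr1 g tv x (f1 x) (f2 x)) (k1 x))
      (A0 * (s / 2 * (2 * f0 ξ * f1 ξ + (symWeight p tv ξ ^ 2 * deriv (deriv p) (tv ξ)
            * deriv tv ξ * h0 ξ ^ 2 + symWeight p tv ξ * (2 * h0 ξ * h1 ξ)))
          + (f1 ξ * h0 ξ + f0 ξ * h1 ξ)
          + (f1 ξ * incr0 g tv ξ (f1 ξ) + f0 ξ * incr1 g tv ξ (f1 ξ) (f2 ξ)))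
        + A1 * (s / 2 * (2 * f1 ξ * f2 ξ + (symWeight p tv ξ ^ 2 * deriv (deriv p) (tv ξ)
            * deriv tv ξ * h1 ξ ^ 2 + symWeight p tv ξ * (2 * h1 ξ * h2 ξ)))
          + (f2 ξ * h1 ξ + f1 ξ * h2 ξ)
          + (f2 ξ * incr1 g tv ξ (f1 ξ) (f2 ξ) + f1 ξ * incr2 g tv ξ (f1 ξ) (f2 ξ) (f3 ξ)))
        + A2 * (f3 ξ * k1 ξ + f2 ξ * k2 ξ - s / 2 * (2 * f2 ξ * f3 ξ)
          + s / 2 * (symWeight p tv ξ ^ 2 * deriv (deriv p) (tv ξ) * deriv tv ξ * h2 ξ ^ 2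
            + symWeight p tv ξ * (2 * h2 ξ * h3 ξ)))
        - s * (f2 ξ * h2 ξ + f1 ξ * h3 ξ)) ξ := by
  have sq : ∀ {u : ℝ → ℝ} {u' : ℝ}, HasDerivAt u u' ξ →
      HasDerivAt (fun x => u x ^ 2) (2 * u ξ * u') ξ := by
    intro u u' hu
    exact (hu.pow 2).congr_deriv (by simp)
  have dw := hB.hasDerivAt_weight ξ
  have dQ := hasDerivAt_incr0 hB.hasDerivAt_g (hB.hasDerivAt_tv ξ) (hS.df1 ξ)
      (hB.tv_pos ξ) (hB.tv_add_pos ξ (hr ξ))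
  have dN := hasDerivAt_incr1 hB.hasDerivAt_g1 (hB.hasDerivAt_tv ξ) (hB.hasDerivAt_tv1 ξ)
      (hS.df1 ξ) (hS.df2 ξ) (hB.tv_pos ξ) (hB.tv_add_pos ξ (hr ξ))
  exact (((((((sq (hS.df0 ξ)).add (dw.mul (sq (hS.dh0 ξ)))).const_mul (s / 2)).add
      ((hS.df0 ξ).mul (hS.dh0 ξ))).add ((hS.df0 ξ).mul dQ)).const_mul A0).add
    ((((((sq (hS.df1 ξ)).add (dw.mul (sq (hS.dh1 ξ)))).const_mul (s / 2)).add
      ((hS.df1 ξ).mul (hS.dh1 ξ))).add ((hS.df1 ξ).mul dN)).const_mul A1)).add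
    (((((hS.df2 ξ).mul (hS.dk1 ξ)).sub ((sq (hS.df2 ξ)).const_mul (s / 2))).add
      ((dw.mul (sq (hS.dh2 ξ))).const_mul (s / 2))).const_mul A2) |>.sub
    (((hS.df1 ξ).mul (hS.dh2 ξ)).const_mul s)

/-- The pointwise energy inequality: up to a spatial divergence, the energy decays at rate
at least `h2 ^ 2 / 2`. -/
lemma energyRate_le (hS : IsSlice p g tv s f0 f1 f2 f3 h0 h1 h2 h3 k0 k1 k2 m0 m1 m2)
    (hB : CoeffBounds p g tv s c M r) {d A0 A1 A2 : ℝ} (hd1 : d ≤ 1) (hdr : d ≤ r)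
    (hA : ∀ x y z h X0 X1 X2 X3 : ℝ,
        X0 ≤ -c * x ^ 2 + 2 * M ^ 3 * d * x ^ 2 →
        X1 ≤ -c * y ^ 2 + 2 * M ^ 3 * (x * y) + 2 * M ^ 3 * x ^ 2 →
        X2 ≤ -c * z ^ 2 + 2 * M ^ 3 * (z * (x + y)) + 2 * M ^ 3 * (h * (x + y))
          + 2 * M ^ 3 * d * (h * z) →
        X3 ≤ -h ^ 2 + 2 * M ^ 3 * (h * (x + y + z)) + 2 * M ^ 3 * (x * (x + y + z)) →
        0 ≤ h → 0 ≤ z →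
        A0 * X0 + A1 * X1 + A2 * X2 + X3 ≤ -h ^ 2 / 2)
    (hf1 : ∀ ξ, |f1 ξ| ≤ d) (hf2 : ∀ ξ, |f2 ξ| ≤ d) (hh0 : ∀ ξ, |h0 ξ| ≤ d)
    (hh1 : ∀ ξ, |h1 ξ| ≤ d) (ξ : ℝ) :
    ∃ q', HasDerivAt (fun x => energyFlux A0 A1 A2 s (symWeight p tv x) (f0 x) (f1 x) (f2 x)
        (h0 x) (h1 x) (h2 x) (incr0 g tv x (f1 x)) (incr1 g tv x (f1 x) (f2 x)) (k1 x)) q' ξ ∧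
      energyRate A0 A1 A2 (symWeight p tv ξ) (f0 ξ) (f1 ξ) (f2 ξ) (h0 ξ) (h1 ξ) (h2 ξ)
        (k0 ξ) (k1 ξ) (k2 ξ) (m0 ξ) (m1 ξ) (m2 ξ) + h2 ξ ^ 2 / 2 ≤ q' := by
  have hr : ∀ ξ, |f1 ξ| ≤ r := fun ξ => (hf1 ξ).trans hdr
  refine ⟨_, hS.hasDerivAt_energyFlux hB hr A0 A1 A2 ξ, ?_⟩
  have hM := hB.incr_p.one_le
  have hs : s ≤ 0 := by
    have := hB.one_le_mul_neg_s
    by_contra! h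
    nlinarith
  have ha1 := hB.tv1_nonpos ξ
  have hp2 := hB.p2_nonneg ξ
  have hw := hB.abs_weight_le ξ
  have hG := hB.le_g1 ξ _ (hr ξ)
  have hwp := hB.weight_mul ξ
  have hf2' : |f2 ξ| ≤ 1 := (hf2 ξ).trans hd1
  have L0 := zeroth_level_le hM hs ha1 hp2 hw (hB.incr_p.tay0 ξ _ (hr ξ))
    (hB.g_mono ξ _ (hr ξ)) (hh0 ξ)
  have L1 := first_level_le (f2 := f2 ξ) hM hd1 hB.one_le_mul_neg_s ha1 (hB.abs_tv1_le ξ) hp2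
    (hB.incr_p.bdd2 ξ |>.trans le_rfl) hw hG (hB.incr_g.lip1 ξ _ (hr ξ))
    (hB.incr_p.lip1 ξ _ (hr ξ)) (hB.incr_p.tay1 ξ _ (hr ξ)) (hh1 ξ)
  have hN := hB.incr_g.incr2_le ξ _ _ (f3 ξ) (hr ξ) hf2'
  have hP := hB.incr_p.incr2_le ξ _ _ (f3 ξ) (hr ξ) hf2'
  have L2 := second_level_le (h2 := h2 ξ) hM hs ha1 hp2 hw hG hN hP
    (by rw [sub_sub_cancel]; exact hwp) (hB.incr_p.lip1 ξ _ (hr ξ)) (hf1 ξ)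
  have L3 := cross_level_le (h2 := h2 ξ) hM (hB.incr_g.bdd1 ξ _ (hr ξ))
    (hB.incr_p.bdd1 ξ _ (hr ξ)) hN hP
  rw [← sq_abs (f1 ξ)] at L0
  have key := hA _ _ _ _ _ _ _ _ (L0.trans (by rw [sq_abs])) (L1.trans (by rw [sq_abs (f2 ξ)])) L2 L3
    (abs_nonneg _) (abs_nonneg _)
  rw [sq_abs] at key
  rw [hS.eq_k0, hS.eq_m0, hS.eq_k1 hB hr, hS.eq_m1 hB hr, hS.eq_m2 hB hr]
  generalize hw' : symWeight p tv ξ = w at *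
  unfold energyRate
  rw [← sub_nonpos]
  rw [← sub_nonpos] at key
  refine le_of_eq_of_le ?_ key
  simp only [incr1]
  linear_combination (-A0 * h0 ξ * f1 ξ - A1 * h1 ξ * f2 ξ) * hwp

lemma abs_energyFlux_le (hS : IsSlice p g tv s f0 f1 f2 f3 h0 h1 h2 h3 k0 k1 k2 m0 m1 m2)
    (hB : CoeffBounds p g tv s c M r) {η A0 A1 A2 : ℝ} (hη : η ≤ 1) (hr : ∀ ξ, |f1 ξ| ≤ r)
    (hA0 : 0 < A0) (hA1 : 0 < A1) (hA2 : 0 < A2) {ξ : ℝ}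
    (hf0 : |f0 ξ| ≤ η) (hf1 : |f1 ξ| ≤ η) (hf2 : |f2 ξ| ≤ η) (hf3 : |f3 ξ| ≤ η)
    (hh0 : |h0 ξ| ≤ η) (hh1 : |h1 ξ| ≤ η) (hh2 : |h2 ξ| ≤ η) :
    |energyFlux A0 A1 A2 s (symWeight p tv ξ) (f0 ξ) (f1 ξ) (f2 ξ)
        (h0 ξ) (h1 ξ) (h2 ξ) (incr0 g tv ξ (f1 ξ)) (incr1 g tv ξ (f1 ξ) (f2 ξ)) (k1 ξ)|
      ≤ (A0 + A1 + A2 + 1) * (6 * M ^ 2) * η := by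
  have hM := hB.incr_p.one_le
  have hM0 : 0 < M := by linarith
  have hη0 : 0 ≤ η := (abs_nonneg _).trans hf0
  have hηη : η * η ≤ η * 1 := by gcongr
  have mul_bd : ∀ {a b : ℝ}, |a| ≤ η → |b| ≤ η → |a * b| ≤ η := fun ha hb =>
    (abs_mul_le_mul ha hb).trans (by linarith)
  have hs := hB.abs_s_le
  have hs2 : |s / 2| ≤ M / 2 := by
    rw [abs_div, abs_two]
    linarith
  have hw := hB.abs_weight_le ξ
  have sq_bd : ∀ {a : ℝ}, |a| ≤ η → |a ^ 2| ≤ η := fun ha => by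
    rw [sq]; exact mul_bd ha ha
  have wsq_bd : ∀ {a : ℝ}, |a| ≤ η → |symWeight p tv ξ * a ^ 2| ≤ M * η := fun ha =>
    abs_mul_le_mul hw (sq_bd ha)
  have hQ : |incr0 g tv ξ (f1 ξ)| ≤ M * η :=
    (hB.incr_g.lip0 ξ _ (hr ξ)).trans (by gcongr)
  have hN : |incr1 g tv ξ (f1 ξ) (f2 ξ)| ≤ M * (η + η) :=
    (hB.incr_g.incr1_le ξ _ _ (hr ξ)).trans (by gcongr)
  have hk : |k1 ξ| ≤ M * η + η + (M * (η + η) + M * η) := by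
    have e : k1 ξ = s * f2 ξ + h2 ξ + ((incr2 g tv ξ (f1 ξ) (f2 ξ) (f3 ξ)
        - deriv g (tv ξ + f1 ξ) * f3 ξ) + deriv g (tv ξ + f1 ξ) * f3 ξ) := by
      rw [hS.eq_k1 hB hr]; ring
    rw [e]
    have t1 : |s * f2 ξ| ≤ M * η := abs_mul_le_mul hs hf2
    have t2 : |deriv g (tv ξ + f1 ξ) * f3 ξ| ≤ M * η :=
      abs_mul_le_mul (hB.incr_g.bdd1 ξ _ (hr ξ)) hf3
    have t3 : |incr2 g tv ξ (f1 ξ) (f2 ξ) (f3 ξ) - deriv g (tv ξ + f1 ξ) * f3 ξ| ≤ M * (η + η) :=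
      (hB.incr_g.incr2_le ξ _ _ _ (hr ξ) (hf2.trans hη)).trans (by gcongr)
    exact (abs_add_le _ _).trans (add_le_add ((abs_add_le _ _).trans (add_le_add t1 hh2))
      ((abs_add_le _ _).trans (add_le_add t3 t2)))
  have small : ∀ {a b B : ℝ}, |a| ≤ η → |b| ≤ B → |a * b| ≤ B := fun ha hb => by
    simpa using abs_mul_le_mul (ha.trans hη) hb
  have m1 : M * η ≤ M ^ 2 * η := by
    gcongr
    nlinarith
  have m2 : η ≤ M * η := by nlinarith
  have quad : ∀ {a b : ℝ}, |a| ≤ η → |b| ≤ η →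
      |s / 2 * (a ^ 2 + symWeight p tv ξ * b ^ 2)| ≤ M ^ 2 * η := by
    intro a b ha hb
    have t := abs_mul_le_mul hs2
      ((abs_add_le _ _).trans (add_le_add (sq_bd ha) (wsq_bd hb)))
    refine t.trans ?_
    linarith
  have E0 : |A0 * (s / 2 * (f0 ξ ^ 2 + symWeight p tv ξ * h0 ξ ^ 2) + f0 ξ * h0 ξ
      + f0 ξ * incr0 g tv ξ (f1 ξ))| ≤ A0 * (6 * M ^ 2 * η) := by
    rw [abs_mul, abs_of_pos hA0]
    gcongr
    refine (abs_add_three _ _ _).trans ?_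
    linarith [quad hf0 hh0, mul_bd hf0 hh0, small hf0 hQ]
  have E1 : |A1 * (s / 2 * (f1 ξ ^ 2 + symWeight p tv ξ * h1 ξ ^ 2) + f1 ξ * h1 ξ
      + f1 ξ * incr1 g tv ξ (f1 ξ) (f2 ξ))| ≤ A1 * (6 * M ^ 2 * η) := by
    rw [abs_mul, abs_of_pos hA1]
    gcongr
    refine (abs_add_three _ _ _).trans ?_
    linarith [quad hf1 hh1, mul_bd hf1 hh1, small hf1 hN]
  have E2 : |A2 * (f2 ξ * k1 ξ - s / 2 * f2 ξ ^ 2 + s / 2 * (symWeight p tv ξ * h2 ξ ^ 2))|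
      ≤ A2 * (6 * M ^ 2 * η) := by
    rw [abs_mul, abs_of_pos hA2]
    gcongr
    refine (abs_add_le _ _).trans ((add_le_add_left (abs_sub _ _) _).trans ?_)
    have t1 := abs_mul_le_mul hs2 (sq_bd hf2)
    have t2 := abs_mul_le_mul hs2 (wsq_bd hh2)
    linarith [small hf2 hk]
  have E3 : |s * (f1 ξ * h2 ξ)| ≤ 6 * M ^ 2 * η := by
    have := abs_mul_le_mul hs (mul_bd hf1 hh2)
    have h0 : 0 ≤ M ^ 2 * η := by positivity
    linarith
  unfold energyFlux
  refine (abs_sub _ _).trans ?_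
  have := abs_add_three (A0 * (s / 2 * (f0 ξ ^ 2 + symWeight p tv ξ * h0 ξ ^ 2) + f0 ξ * h0 ξ
      + f0 ξ * incr0 g tv ξ (f1 ξ))) (A1 * (s / 2 * (f1 ξ ^ 2 + symWeight p tv ξ * h1 ξ ^ 2)
      + f1 ξ * h1 ξ + f1 ξ * incr1 g tv ξ (f1 ξ) (f2 ξ)))
      (A2 * (f2 ξ * k1 ξ - s / 2 * f2 ξ ^ 2 + s / 2 * (symWeight p tv ξ * h2 ξ ^ 2)))
  linarith

end IsSlice

/-- Exchange of the order of differentiation: if `b = ∂_x a`, then `∂_x ∂_t a = ∂_t b`. -/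
lemma hasDerivAt_deriv_comm {a b : ℝ → ℝ → ℝ} {T t : ℝ} (ht : t ∈ Ioo 0 T)
    (hab : ∀ τ ∈ Icc 0 T, ∀ x, HasDerivAt (a τ) (b τ x) x)
    (ha : ∀ τ ∈ Icc 0 T, ∀ x, DifferentiableAt ℝ (fun σ => a σ x) τ)
    (hb : ∀ τ ∈ Icc 0 T, ∀ x, DifferentiableAt ℝ (fun σ => b σ x) τ)
    (hbc : ContinuousOn (fun q : ℝ × ℝ => b q.1 q.2) (Icc 0 T ×ˢ univ))
    (hbt : ContinuousOn (fun q : ℝ × ℝ => deriv (fun σ => b σ q.2) q.1) (Icc 0 T ×ˢ univ))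
    (ξ : ℝ) :
    HasDerivAt (fun x => deriv (fun σ => a σ x) t) (deriv (fun σ => b σ ξ) t) ξ := by
  have htI : t ∈ Icc 0 T := Ioo_subset_Icc_self ht
  have hnhds : Icc 0 T ∈ 𝓝 t := Icc_mem_nhds ht.1 ht.2
  have slice : ∀ {H : ℝ × ℝ → ℝ}, ContinuousOn H (Icc 0 T ×ˢ univ) → ∀ τ ∈ Icc 0 T,
      Continuous fun x => H (τ, x) := fun hH τ hτ =>
    hH.comp_continuous (Continuous.prodMk_right τ) fun x => ⟨hτ, mem_univ x⟩
  have hcont := slice hbt t htI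
  have key : ∀ x, deriv (fun σ => a σ x) t
      = deriv (fun σ => a σ ξ) t + ∫ y in ξ..x, deriv (fun σ => b σ y) t := by
    intro x
    obtain ⟨K, hK⟩ := (isCompact_Icc.prod
      (isCompact_uIcc (a := ξ) (b := x))).exists_bound_of_continuousOn (hbt.mono (prod_mono_right (subset_univ _)))
    have hint := (intervalIntegral.hasDerivAt_integral_of_dominated_loc_of_deriv_le
      (μ := volume) (a := ξ) (b := x) (F := b) (F' := fun τ y => deriv (fun σ => b σ y) τ)
      (bound := fun _ => K) hnhds
      (by
        filter_upwards [hnhds] with τ hτ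
        exact (slice hbc τ hτ).aestronglyMeasurable)
      ((slice hbc t htI).intervalIntegrable _ _)
      hcont.aestronglyMeasurable
      (Eventually.of_forall fun y hy τ hτ => hK (τ, y) ⟨hτ, uIoc_subset_uIcc hy⟩)
      intervalIntegrable_const
      (Eventually.of_forall fun y _ τ hτ => (hb τ hτ y).hasDerivAt)).2
    have heq : (fun σ => a σ x) =ᶠ[𝓝 t] fun σ => a σ ξ + ∫ y in ξ..x, b σ y := by
      filter_upwards [hnhds] with τ hτ
      rw [intervalIntegral.integral_eq_sub_of_hasDerivAt (fun y _ => hab τ hτ y)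
        ((slice hbc τ hτ).intervalIntegrable _ _)]
      ring
    rw [heq.deriv_eq]
    exact ((ha t htI ξ).hasDerivAt.add hint).deriv
  rw [funext key]
  exact ((intervalIntegral.integral_hasDerivAt_right (hcont.intervalIntegrable _ _)
    (hcont.stronglyMeasurableAtFilter _ _) hcont.continuousAt).const_add _)

lemma integrableOn_rectangle {F : ℝ → ℝ → ℝ} {T t R : ℝ}
    (hF : ContinuousOn (fun q : ℝ × ℝ => F q.1 q.2) (Icc 0 T ×ˢ univ)) (ht : t ∈ Icc 0 T) :
    IntegrableOn (Function.uncurry F) (uIoc 0 t ×ˢ uIoc (-R) R) := by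
  have h0 : uIcc 0 t ⊆ Icc 0 T := by
    rw [uIcc_of_le ht.1]
    exact Icc_subset_Icc_right ht.2
  exact ((hF.mono (prod_mono h0 (subset_univ (uIcc (-R) R)))).integrableOn_compact
    (isCompact_uIcc.prod isCompact_uIcc)).mono_set (prod_mono uIoc_subset_uIcc uIoc_subset_uIcc)

lemma intervalIntegrable_integral {F : ℝ → ℝ → ℝ} {T t R : ℝ}
    (hF : ContinuousOn (fun q : ℝ × ℝ => F q.1 q.2) (Icc 0 T ×ˢ univ)) (ht : t ∈ Icc 0 T)
    (hR : 0 ≤ R) :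
    IntervalIntegrable (fun τ => ∫ ξ in -R..R, F τ ξ) volume 0 t := by
  have h := integrableOn_rectangle (R := R) hF ht
  rw [IntegrableOn, Measure.volume_eq_prod, ← Measure.prod_restrict] at h
  have h1 := h.integral_prod_left
  rw [intervalIntegrable_iff]
  refine h1.congr (Eventually.of_forall fun τ => ?_)
  simp only [Function.uncurry, uIoc_of_le (show -R ≤ R by linarith),
    intervalIntegral.integral_of_le (show -R ≤ R by linarith)]

/-- If a nonnegative energy with density `e` dissipates `D` up to an error `ε` on `[-R, R]`, then
the total dissipation is controlled by the initial energy. -/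
lemma integral_dissipation_le {e et D : ℝ → ℝ → ℝ} {T t R ε : ℝ} (ht : t ∈ Icc 0 T) (hR : 0 ≤ R)
    (he0 : ∀ ξ, 0 ≤ e t ξ)
    (hec : Continuous (e 0)) (hetc : Continuous (e t))
    (hde : ∀ τ ∈ Icc 0 T, ∀ ξ, HasDerivAt (fun σ => e σ ξ) (et τ ξ) τ)
    (het : ContinuousOn (fun q : ℝ × ℝ => et q.1 q.2) (Icc 0 T ×ˢ univ))
    (hD : ContinuousOn (fun q : ℝ × ℝ => D q.1 q.2) (Icc 0 T ×ˢ univ))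
    (hdiss : ∀ τ ∈ Ioo 0 T, ∫ ξ in -R..R, (et τ ξ + D τ ξ) ≤ ε) :
    ∫ τ in 0..t, ∫ ξ in -R..R, D τ ξ ≤ (∫ ξ in -R..R, e 0 ξ) + ε * t := by
  have hsub : Icc 0 t ⊆ Icc 0 T := Icc_subset_Icc_right ht.2
  have slice : ∀ {H : ℝ → ℝ → ℝ}, ContinuousOn (fun q : ℝ × ℝ => H q.1 q.2) (Icc 0 T ×ˢ univ) →
      ∀ τ ∈ Icc 0 T, IntervalIntegrable (H τ) volume (-R) R := fun hH τ hτ =>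
    (hH.comp_continuous (Continuous.prodMk_right τ)
      fun x => ⟨hτ, mem_univ x⟩).intervalIntegrable _ _
  have sliceT : ∀ ξ, IntervalIntegrable (fun τ => et τ ξ) volume 0 t := fun ξ => by
    refine ContinuousOn.intervalIntegrable ?_
    rw [uIcc_of_le ht.1]
    exact het.comp (Continuous.prodMk_left ξ).continuousOn fun τ hτ => ⟨hsub hτ, mem_univ ξ⟩
  have hswap : ∫ τ in 0..t, ∫ ξ in -R..R, et τ ξ = ∫ ξ in -R..R, (e t ξ - e 0 ξ) := by
    rw [intervalIntegral_intervalIntegral_swap (integrableOn_rectangle het ht)]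
    refine intervalIntegral.integral_congr fun ξ _ => ?_
    refine intervalIntegral.integral_eq_sub_of_hasDerivAt (f := fun σ => e σ ξ)
      (fun τ hτ => hde τ ?_ ξ) (sliceT ξ)
    rw [uIcc_of_le ht.1] at hτ
    exact hsub hτ
  rw [intervalIntegral.integral_sub (hetc.intervalIntegrable _ _)
    (hec.intervalIntegrable _ _)] at hswap
  have hpos : 0 ≤ ∫ ξ in -R..R, e t ξ :=
    intervalIntegral.integral_nonneg (by linarith) fun ξ _ => he0 ξ
  have hsum : ∫ τ in 0..t, ((∫ ξ in -R..R, et τ ξ) + ∫ ξ in -R..R, D τ ξ) ≤ ∫ _ in 0..t, ε := by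
    refine intervalIntegral.integral_mono_on_of_le_Ioo ht.1
      ((intervalIntegrable_integral het ht hR).add (intervalIntegrable_integral hD ht hR))
      intervalIntegrable_const fun τ hτ => ?_
    have hτ' : τ ∈ Ioo 0 T := Ioo_subset_Ioo_right ht.2 hτ
    have := hdiss τ hτ'
    rwa [intervalIntegral.integral_add (slice het τ (Ioo_subset_Icc_self hτ'))
      (slice hD τ (Ioo_subset_Icc_self hτ'))] at this
  rw [intervalIntegral.integral_add (intervalIntegrable_integral het ht hR)
    (intervalIntegrable_integral hD ht hR), intervalIntegral.integral_const] at hsum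
  simp only [sub_zero, smul_eq_mul] at hsum
  linarith

/-- One-dimensional Sobolev inequality for functions vanishing at `-∞`. -/
lemma sq_le_integral_sq_add {u v : ℝ → ℝ} (huv : ∀ x, HasDerivAt u (v x) x) (hv : Continuous v)
    (hu2 : Integrable fun x => u x ^ 2) (hv2 : Integrable fun x => v x ^ 2)
    (h0 : Tendsto u atBot (𝓝 0)) (x : ℝ) :
    u x ^ 2 ≤ (∫ y, u y ^ 2) + ∫ y, v y ^ 2 := by
  have hu : Continuous u := continuous_iff_continuousAt.2 fun y => (huv y).continuousAt
  have hle : ∀ y, |2 * u y * v y| ≤ u y ^ 2 + v y ^ 2 := fun y => by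
    rw [abs_le]
    constructor <;> nlinarith [sq_nonneg (u y - v y), sq_nonneg (u y + v y)]
  have hint : Integrable fun y => 2 * u y * v y :=
    (hu2.add hv2).mono' (by fun_prop) (Eventually.of_forall hle)
  have hd : ∀ y ∈ Iic x, HasDerivAt (fun y => u y ^ 2) (2 * u y * v y) y := fun y _ =>
    ((huv y).pow 2).congr_deriv (by simp)
  have hlim : Tendsto (fun y => u y ^ 2) atBot (𝓝 0) := by simpa using h0.pow 2
  have e := integral_Iic_of_hasDerivAt_of_tendsto' hd hint.integrableOn hlim
  rw [sub_zero] at e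
  rw [← e, ← integral_add hu2 hv2]
  refine (setIntegral_mono hint.integrableOn (hu2.add hv2).integrableOn
    fun y => (le_abs_self _).trans (hle y)).trans ?_
  exact setIntegral_le_integral (hu2.add hv2)
    (Eventually.of_forall fun y => add_nonneg (sq_nonneg _) (sq_nonneg _))

lemma exists_coeffBounds {p μ g tv : ℝ → ℝ} {vp vm s : ℝ}
    (hp : ContDiffOn ℝ (⊤ : ℕ∞) p (Ioi 0)) (hpd : ∀ v ∈ Ioi (0 : ℝ), deriv p v < 0)
    (hpdd : ∀ v ∈ Ioi (0 : ℝ), 0 ≤ deriv (deriv p) v)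
    (hmu : ContDiffOn ℝ (⊤ : ℕ∞) μ (Ioi 0)) (hmu_pos : ∀ v ∈ Ioi (0 : ℝ), 0 < μ v)
    (hvp : 0 < vp) (hs : s < 0) (hg : ∀ z ∈ Ioi (0 : ℝ), HasDerivAt g (μ z / z) z)
    (htv : ContDiff ℝ (⊤ : ℕ∞) tv) (htv_mem : ∀ ξ, tv ξ ∈ Ioo vp vm)
    (htv_dec : ∀ ξ, deriv tv ξ < 0)
    (htv_bdd : ∀ k : ℕ, ∃ M : ℝ, ∀ ξ : ℝ, |iteratedDeriv k tv ξ| ≤ M) :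
    ∃ c M, CoeffBounds p g tv s c M (vp / 2) := by
  have hα : 0 < vp / 2 := by linarith
  have hg1 : ∀ z ∈ Ioi (0 : ℝ), deriv g z = μ z / z := fun z hz => (hg z hz).deriv
  have hg1s : ContDiffOn ℝ (⊤ : ℕ∞) (deriv g) (Ioi 0) :=
    (hmu.div contDiffOn_id fun z hz => ne_of_gt hz).congr hg1
  have hgs : ContDiffOn ℝ (⊤ : ℕ∞) g (Ioi 0) :=
    (contDiffOn_infty_iff_deriv_of_isOpen isOpen_Ioi).2
      ⟨fun z hz => (hg z hz).differentiableAt.differentiableWithinAt, hg1s⟩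
  have hp1 : ContDiffOn ℝ (⊤ : ℕ∞) (deriv p) (Ioi 0) := hp.deriv_of_isOpen isOpen_Ioi le_rfl
  have hd : ∀ {H : ℝ → ℝ}, ContDiffOn ℝ (⊤ : ℕ∞) H (Ioi 0) → ∀ z > 0,
      HasDerivAt H (deriv H z) z := fun hH z hz =>
    ((hH.differentiableOn (by simp)).differentiableAt (Ioi_mem_nhds hz)).hasDerivAt
  have htv1 : ContDiff ℝ (⊤ : ℕ∞) (deriv tv) := (contDiff_infty_iff_deriv.1 htv).2
  obtain ⟨B1, hB1⟩ := htv_bdd 1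
  obtain ⟨B2, hB2⟩ := htv_bdd 2
  simp only [iteratedDeriv_succ, iteratedDeriv_zero] at hB1 hB2
  obtain ⟨Mp, hMp⟩ := exists_incrBounds hp hvp htv_mem (B := max B1 B2)
    (fun ξ => (hB1 ξ).trans (le_max_left _ _)) fun ξ => (hB2 ξ).trans (le_max_right _ _)
  obtain ⟨Mg, hMg⟩ := exists_incrBounds hgs hvp htv_mem (B := max B1 B2)
    (fun ξ => (hB1 ξ).trans (le_max_left _ _)) fun ξ => (hB2 ξ).trans (le_max_right _ _)
  have hvm : vp < vm := (htv_mem 0).1.trans (htv_mem 0).2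
  have hsub : Icc (vp / 2) (vm + vp / 2) ⊆ Ioi 0 := fun z hz => lt_of_lt_of_le hα hz.1
  have hne : (Icc (vp / 2) (vm + vp / 2)).Nonempty := ⟨vp, by linarith, by linarith⟩
  obtain ⟨zg, hzg, hming⟩ := isCompact_Icc.exists_isMinOn hne (hg1s.continuousOn.mono hsub)
  have hw : ContinuousOn (fun z => -(deriv p z)⁻¹) (Icc (vp / 2) (vm + vp / 2)) :=
    ((hp1.continuousOn.mono hsub).inv₀ fun z hz => (hpd z (hsub hz)).ne).neg
  obtain ⟨zp, hzp, hminp⟩ := isCompact_Icc.exists_isMinOn hne hw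
  obtain ⟨Zp, -, hmaxp⟩ := isCompact_Icc.exists_isMaxOn hne hw
  have hcg : 0 < deriv g zg := by
    rw [hg1 _ (hsub hzg)]
    exact div_pos (hmu_pos _ (hsub hzg)) (hsub hzg)
  have hcp : 0 < -(deriv p zp)⁻¹ := neg_pos.2 (inv_lt_zero.2 (hpd _ (hsub hzp)))
  have ma : ∀ ξ, tv ξ ∈ Icc (vp / 2) (vm + vp / 2) := fun ξ =>
    ⟨by linarith [(htv_mem ξ).1], by linarith [(htv_mem ξ).2]⟩
  have mb : ∀ ξ y, |y| ≤ vp / 2 → tv ξ + y ∈ Icc (vp / 2) (vm + vp / 2) := fun ξ y hy =>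
    ⟨by linarith [(htv_mem ξ).1, (abs_le.1 hy).1], by linarith [(htv_mem ξ).2, (abs_le.1 hy).2]⟩
  set c := min (deriv g zg) (-(deriv p zp)⁻¹) with hc
  have hc0 : 0 < c := lt_min hcg hcp
  have hcg' : ∀ z ∈ Icc (vp / 2) (vm + vp / 2), c ≤ deriv g z := fun z hz =>
    (min_le_left _ _).trans (hming hz)
  obtain ⟨M, h1, h2, h3, h4, h5, h6⟩ : ∃ M, Mp ≤ M ∧ Mg ≤ M ∧ |s| ≤ M ∧ (-s)⁻¹ ≤ M ∧ B1 ≤ M ∧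
      -(deriv p Zp)⁻¹ ≤ M :=
    ⟨max Mp (max Mg (max |s| (max (-s)⁻¹ (max B1 (-(deriv p Zp)⁻¹))))), by simp⟩
  refine ⟨c, M, ?_⟩
  constructor
  case c_pos => exact hc0
  case r_pos => exact hα
  case one_le_mul_neg_s =>
    calc (1 : ℝ) = (-s)⁻¹ * -s := (inv_mul_cancel₀ (by linarith)).symm
      _ ≤ M * -s := by gcongr; linarith
  case abs_s_le => exact h3
  case r_lt => exact fun ξ => by linarith [(htv_mem ξ).1]
  case hasDerivAt_p => exact hd hp
  case hasDerivAt_p1 => exact hd hp1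
  case hasDerivAt_g => exact hd hgs
  case hasDerivAt_g1 => exact hd hg1s
  case hasDerivAt_tv => exact fun ξ => (htv.differentiable (by simp) ξ).hasDerivAt
  case hasDerivAt_tv1 => exact fun ξ => (htv1.differentiable (by simp) ξ).hasDerivAt
  case tv1_nonpos => exact fun ξ => (htv_dec ξ).le
  case abs_tv1_le => exact fun ξ => (hB1 ξ).trans h5
  case p1_ne => exact fun ξ => (hpd _ (hsub (ma ξ))).ne
  case p2_nonneg => exact fun ξ => hpdd _ (hsub (ma ξ))
  case le_weight => exact fun ξ => (min_le_right _ _).trans (hminp (ma ξ))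
  case weight_le => exact fun ξ => (hmaxp (ma ξ)).trans h6
  case incr_p => exact hMp.mono h1
  case incr_g => exact hMg.mono h2
  case le_g1 => exact fun ξ y hy => hcg' _ (mb ξ y hy)
  case g_mono =>
    intro ξ y hy
    have mono : ∀ a ∈ Icc (vp / 2) (vm + vp / 2), ∀ b ∈ Icc (vp / 2) (vm + vp / 2), a ≤ b →
        c * (b - a) ≤ g b - g a := by
      refine (convex_Icc _ _).mul_sub_le_image_sub_of_le_deriv (hgs.continuousOn.mono hsub)
        ((hgs.differentiableOn (by simp)).mono (interior_subset.trans hsub)) fun z hz => ?_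
      exact hcg' z (interior_subset hz)
    unfold incr0
    rcases le_total 0 y with h | h
    · have := mono _ (ma ξ) _ (mb ξ y hy) (by linarith)
      nlinarith
    · have := mono _ (mb ξ y hy) _ (ma ξ) (by linarith)
      nlinarith

lemma hasDerivAt_energyDensity {A0 A1 A2 w t k0 k1 k2 m0 m1 m2 : ℝ} {f0 f1 f2 h0 h1 h2 : ℝ → ℝ}
    (hf0 : HasDerivAt f0 k0 t) (hf1 : HasDerivAt f1 k1 t) (hf2 : HasDerivAt f2 k2 t)
    (hh0 : HasDerivAt h0 m0 t) (hh1 : HasDerivAt h1 m1 t) (hh2 : HasDerivAt h2 m2 t) :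
    HasDerivAt (fun σ => energyDensity A0 A1 A2 w (f0 σ) (f1 σ) (f2 σ) (h0 σ) (h1 σ) (h2 σ))
      (energyRate A0 A1 A2 w (f0 t) (f1 t) (f2 t) (h0 t) (h1 t) (h2 t) k0 k1 k2 m0 m1 m2) t := by
  have level : ∀ {A k m : ℝ} {f h : ℝ → ℝ}, HasDerivAt f k t → HasDerivAt h m t →
      HasDerivAt (fun σ => A / 2 * (f σ ^ 2 + w * h σ ^ 2)) (A * (f t * k + w * (h t * m))) t := by
    intro A k m f h hf hh
    refine ((hf.fun_pow 2).add ((hh.fun_pow 2).const_mul w)).const_mul (A / 2) |>.congr_deriv ?_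
    push_cast
    ring
  exact (((level hf0 hh0).add (level hf1 hh1)).add (level hf2 hh2)).sub (hf1.mul hh2)

lemma continuousOn_energyRate {X : Type*} [TopologicalSpace X] {S : Set X} {A0 A1 A2 : ℝ}
    {w f0 f1 f2 h0 h1 h2 k0 k1 k2 m0 m1 m2 : X → ℝ} (hw : ContinuousOn w S)
    (hf0 : ContinuousOn f0 S) (hf1 : ContinuousOn f1 S) (hf2 : ContinuousOn f2 S)
    (hh0 : ContinuousOn h0 S) (hh1 : ContinuousOn h1 S) (hh2 : ContinuousOn h2 S)
    (hk0 : ContinuousOn k0 S) (hk1 : ContinuousOn k1 S) (hk2 : ContinuousOn k2 S)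
    (hm0 : ContinuousOn m0 S) (hm1 : ContinuousOn m1 S) (hm2 : ContinuousOn m2 S) :
    ContinuousOn (fun q => energyRate A0 A1 A2 (w q) (f0 q) (f1 q) (f2 q) (h0 q) (h1 q) (h2 q)
      (k0 q) (k1 q) (k2 q) (m0 q) (m1 q) (m2 q)) S := by
  unfold energyRate
  fun_prop

lemma continuous_energyDensity {X : Type*} [TopologicalSpace X] {A0 A1 A2 : ℝ}
    {w f0 f1 f2 h0 h1 h2 : X → ℝ} (hw : Continuous w)
    (hf0 : Continuous f0) (hf1 : Continuous f1) (hf2 : Continuous f2)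
    (hh0 : Continuous h0) (hh1 : Continuous h1) (hh2 : Continuous h2) :
    Continuous fun q => energyDensity A0 A1 A2 (w q) (f0 q) (f1 q) (f2 q)
      (h0 q) (h1 q) (h2 q) := by
  unfold energyDensity
  fun_prop

/-- The energy inequality integrated over `[-R, R]`, when the state has size at most `η` at the
two endpoints. -/
lemma IsSlice.integral_energyRate_le {p g tv : ℝ → ℝ} {s c M r : ℝ}
    {f0 f1 f2 f3 h0 h1 h2 h3 k0 k1 k2 m0 m1 m2 : ℝ → ℝ}
    (hS : IsSlice p g tv s f0 f1 f2 f3 h0 h1 h2 h3 k0 k1 k2 m0 m1 m2)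
    (hB : CoeffBounds p g tv s c M r) {d A0 A1 A2 : ℝ} (hd1 : d ≤ 1) (hdr : d ≤ r)
    (hA0 : 0 < A0) (hA1 : 0 < A1) (hA2 : 0 < A2)
    (hA : ∀ x y z h X0 X1 X2 X3 : ℝ,
        X0 ≤ -c * x ^ 2 + 2 * M ^ 3 * d * x ^ 2 →
        X1 ≤ -c * y ^ 2 + 2 * M ^ 3 * (x * y) + 2 * M ^ 3 * x ^ 2 →
        X2 ≤ -c * z ^ 2 + 2 * M ^ 3 * (z * (x + y)) + 2 * M ^ 3 * (h * (x + y))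
          + 2 * M ^ 3 * d * (h * z) →
        X3 ≤ -h ^ 2 + 2 * M ^ 3 * (h * (x + y + z)) + 2 * M ^ 3 * (x * (x + y + z)) →
        0 ≤ h → 0 ≤ z →
        A0 * X0 + A1 * X1 + A2 * X2 + X3 ≤ -h ^ 2 / 2)
    (hf1 : ∀ ξ, |f1 ξ| ≤ d) (hf2 : ∀ ξ, |f2 ξ| ≤ d) (hh0 : ∀ ξ, |h0 ξ| ≤ d)
    (hh1 : ∀ ξ, |h1 ξ| ≤ d) {R η : ℝ} (hR : 0 ≤ R) (hη : η ≤ 1)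
    (hcont : Continuous fun ξ => energyRate A0 A1 A2 (symWeight p tv ξ) (f0 ξ) (f1 ξ) (f2 ξ)
      (h0 ξ) (h1 ξ) (h2 ξ) (k0 ξ) (k1 ξ) (k2 ξ) (m0 ξ) (m1 ξ) (m2 ξ))
    (hend : ∀ ξ, R ≤ |ξ| → |f0 ξ| ≤ η ∧ |f1 ξ| ≤ η ∧ |f2 ξ| ≤ η ∧ |f3 ξ| ≤ η ∧
      |h0 ξ| ≤ η ∧ |h1 ξ| ≤ η ∧ |h2 ξ| ≤ η) :
    ∫ ξ in -R..R, (energyRate A0 A1 A2 (symWeight p tv ξ) (f0 ξ) (f1 ξ) (f2 ξ)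
      (h0 ξ) (h1 ξ) (h2 ξ) (k0 ξ) (k1 ξ) (k2 ξ) (m0 ξ) (m1 ξ) (m2 ξ) + h2 ξ ^ 2 / 2)
      ≤ 2 * ((A0 + A1 + A2 + 1) * (6 * M ^ 2)) * η := by
  choose q' hq' hle using hS.energyRate_le hB hd1 hdr hA hf1 hf2 hh0 hh1
  have hh2c : Continuous h2 := continuous_iff_continuousAt.2 fun ξ => (hS.dh2 ξ).continuousAt
  have hflux : ∀ ξ, R ≤ |ξ| → _ := fun ξ hξ =>
    have ⟨e0, e1, e2, e3, e4, e5, e6⟩ := hend ξ hξ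
    abs_le.1 (hS.abs_energyFlux_le hB hη (fun ξ => (hf1 ξ).trans hdr) hA0 hA1 hA2
      e0 e1 e2 e3 e4 e5 e6)
  have hint := intervalIntegral.integral_le_sub_of_hasDeriv_right_of_le (a := -R) (b := R)
    (by linarith) (continuous_iff_continuousAt.2 fun ξ => (hq' ξ).continuousAt).continuousOn
    (fun ξ _ => (hq' ξ).hasDerivWithinAt)
    (hcont.add ((hh2c.pow 2).div_const 2)).continuousOn.integrableOn_Icc (fun ξ _ => hle ξ)
  have b1 := hflux R (le_abs_self R)
  have b2 := hflux (-R) (by rw [abs_neg]; exact le_abs_self R)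
  exact hint.trans (by linarith [b1.2, b2.1])

lemma L2sq_nonneg (w : ℝ → ℝ) : 0 ≤ L2sq w := integral_nonneg fun _ => sq_nonneg _

lemma L2sq_add_le_pairHkSq_left (F G : ℝ → ℝ) {j : ℕ} (hj : j ≤ 2) :
    L2sq (iteratedDeriv j F) + L2sq (iteratedDeriv (j + 1) F) ≤ pairHkSq 3 F G := by
  have h : ∀ (w : ℝ → ℝ) (i : ℕ), 0 ≤ L2sq (iteratedDeriv i w) := fun w i => L2sq_nonneg _
  have hF := h F
  have hG := h G
  simp only [pairHkSq, HkSq, Finset.sum_range_succ, Finset.sum_range_zero]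
  interval_cases j <;>
    linarith [hF 0, hF 1, hF 2, hF 3, hG 0, hG 1, hG 2, hG 3]

lemma L2sq_add_le_pairHkSq_right (F G : ℝ → ℝ) {j : ℕ} (hj : j ≤ 2) :
    L2sq (iteratedDeriv j G) + L2sq (iteratedDeriv (j + 1) G) ≤ pairHkSq 3 F G := by
  have := L2sq_add_le_pairHkSq_left G F hj
  unfold pairHkSq at *
  linarith

/-- Pointwise bound from an `H¹` bound for functions decaying at infinity. -/
lemma abs_iteratedDeriv_le {F : ℝ → ℝ} {j : ℕ} {N δ : ℝ} (hF : ContDiff ℝ 4 F) (hj : j ≤ 2)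
    (hi : Integrable fun ξ => iteratedDeriv j F ξ ^ 2)
    (hi' : Integrable fun ξ => iteratedDeriv (j + 1) F ξ ^ 2)
    (hdec : ∀ ε > (0 : ℝ), ∃ R : ℝ, ∀ ξ : ℝ, R ≤ |ξ| → |iteratedDeriv j F ξ| < ε)
    (hN : L2sq (iteratedDeriv j F) + L2sq (iteratedDeriv (j + 1) F) ≤ N)
    (hδ : √N ≤ δ) (ξ : ℝ) : |iteratedDeriv j F ξ| ≤ δ := by
  have hjj : (j : WithTop ℕ∞) < 4 := by exact_mod_cast (by omega : j < 4)
  have hj1 : ((j + 1 : ℕ) : WithTop ℕ∞) ≤ 4 := by exact_mod_cast (by omega : j + 1 ≤ 4)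
  have hd : ∀ x, HasDerivAt (iteratedDeriv j F) (iteratedDeriv (j + 1) F x) x := fun x => by
    rw [iteratedDeriv_succ]
    exact (hF.differentiable_iteratedDeriv j hjj x).hasDerivAt
  have hlim : Tendsto (iteratedDeriv j F) atBot (𝓝 0) := by
    rw [Metric.tendsto_nhds]
    intro ε hε
    obtain ⟨R, hR⟩ := hdec ε hε
    filter_upwards [eventually_le_atBot (-R)] with x hx
    rw [Real.dist_eq, sub_zero]
    exact hR x (by linarith [neg_abs_le x])
  have h := sq_le_integral_sq_add hd (hF.continuous_iteratedDeriv (j + 1) hj1) hi hi' hlim ξ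
  refine le_trans ?_ hδ
  rw [← Real.sqrt_sq_eq_abs]
  exact Real.sqrt_le_sqrt (h.trans hN)

lemma hasDerivAt_iteratedDeriv {F : ℝ → ℝ} {j : ℕ} (hF : ContDiff ℝ 4 F) (hj : j < 4) (ξ : ℝ) :
    HasDerivAt (iteratedDeriv j F) (iteratedDeriv (j + 1) F ξ) ξ := by
  rw [iteratedDeriv_succ]
  exact (hF.differentiable_iteratedDeriv j (by exact_mod_cast hj) ξ).hasDerivAt

namespace IsClassicalSolution

variable {p g tv : ℝ → ℝ} {s T : ℝ} {Φ Ψ : ℝ → ℝ → ℝ}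

lemma isSlice (h : IsClassicalSolution p g tv s T Φ Ψ) {τ : ℝ} (hτ : τ ∈ Ioo 0 T) :
    IsSlice p g tv s (iteratedDeriv 0 (Φ τ)) (iteratedDeriv 1 (Φ τ)) (iteratedDeriv 2 (Φ τ))
      (iteratedDeriv 3 (Φ τ)) (iteratedDeriv 0 (Ψ τ)) (iteratedDeriv 1 (Ψ τ))
      (iteratedDeriv 2 (Ψ τ)) (iteratedDeriv 3 (Ψ τ))
      (fun ξ => deriv (fun σ => iteratedDeriv 0 (Φ σ) ξ) τ)
      (fun ξ => deriv (fun σ => iteratedDeriv 1 (Φ σ) ξ) τ)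
      (fun ξ => deriv (fun σ => iteratedDeriv 2 (Φ σ) ξ) τ)
      (fun ξ => deriv (fun σ => iteratedDeriv 0 (Ψ σ) ξ) τ)
      (fun ξ => deriv (fun σ => iteratedDeriv 1 (Ψ σ) ξ) τ)
      (fun ξ => deriv (fun σ => iteratedDeriv 2 (Ψ σ) ξ) τ) := by
  have hI := Ioo_subset_Icc_self hτ
  have dΦ := h.regΦ τ hI
  have dΨ := h.regΨ τ hI
  have commΦ : ∀ j, j ≤ 1 → ∀ ξ, HasDerivAt (fun x => deriv (fun σ => iteratedDeriv j (Φ σ) x) τ)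
      (deriv (fun σ => iteratedDeriv (j + 1) (Φ σ) ξ) τ) ξ := fun j hj ξ =>
    hasDerivAt_deriv_comm hτ
      (fun σ hσ x => hasDerivAt_iteratedDeriv (h.regΦ σ hσ) (by omega) x)
      (h.tdiffΦ j (by omega)) (h.tdiffΦ (j + 1) (by omega)) (h.spContΦ (j + 1) (by omega))
      (h.mixContΦ (j + 1) (by omega)) ξ
  have commΨ : ∀ j, j ≤ 1 → ∀ ξ, HasDerivAt (fun x => deriv (fun σ => iteratedDeriv j (Ψ σ) x) τ)
      (deriv (fun σ => iteratedDeriv (j + 1) (Ψ σ) ξ) τ) ξ := fun j hj ξ =>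
    hasDerivAt_deriv_comm hτ
      (fun σ hσ x => hasDerivAt_iteratedDeriv (h.regΨ σ hσ) (by omega) x)
      (h.tdiffΨ j (by omega)) (h.tdiffΨ (j + 1) (by omega)) (h.spContΨ (j + 1) (by omega))
      (h.mixContΨ (j + 1) (by omega)) ξ
  refine ⟨hasDerivAt_iteratedDeriv dΦ (by norm_num), hasDerivAt_iteratedDeriv dΦ (by norm_num),
    hasDerivAt_iteratedDeriv dΦ (by norm_num), hasDerivAt_iteratedDeriv dΨ (by norm_num),
    hasDerivAt_iteratedDeriv dΨ (by norm_num), hasDerivAt_iteratedDeriv dΨ (by norm_num),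
    commΦ 0 (by norm_num), commΦ 1 le_rfl, commΨ 0 (by norm_num), commΨ 1 le_rfl,
    fun ξ => ?_, fun ξ => ?_⟩
  · have e := h.eq1 τ hI ξ
    unfold Gterm at e
    simp only [iteratedDeriv_zero, iteratedDeriv_one, incr1]
    linear_combination e
  · have e := h.eq2 τ hI ξ
    unfold prel at e
    simp only [iteratedDeriv_zero, iteratedDeriv_one, incr0]
    linear_combination e

lemma abs_le_of_sqrt_le (h : IsClassicalSolution p g tv s T Φ Ψ) {τ δ : ℝ} (hτ : τ ∈ Icc 0 T)
    (hδ : √(pairHkSq 3 (Φ τ) (Ψ τ)) ≤ δ) {j : ℕ} (hj : j ≤ 2) (ξ : ℝ) :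
    |iteratedDeriv j (Φ τ) ξ| ≤ δ ∧ |iteratedDeriv j (Ψ τ) ξ| ≤ δ := by
  refine ⟨abs_iteratedDeriv_le (h.regΦ τ hτ) hj (h.sqIntΦ j (by omega) τ hτ)
    (h.sqIntΦ (j + 1) (by omega) τ hτ) (fun ε hε => ?_) (L2sq_add_le_pairHkSq_left _ _ hj) hδ ξ,
    abs_iteratedDeriv_le (h.regΨ τ hτ) hj (h.sqIntΨ j (by omega) τ hτ)
    (h.sqIntΨ (j + 1) (by omega) τ hτ) (fun ε hε => ?_) (L2sq_add_le_pairHkSq_right _ _ hj) hδ ξ⟩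
  · exact (h.decayΦ j (by omega) ε hε).imp fun R hR => hR τ hτ
  · exact (h.decayΨ j (by omega) ε hε).imp fun R hR => hR τ hτ

lemma eventually_abs_le (h : IsClassicalSolution p g tv s T Φ Ψ) {η : ℝ} (hη : 0 < η) :
    ∀ᶠ R in atTop, ∀ j ≤ 3, ∀ τ ∈ Icc 0 T, ∀ ξ : ℝ, R ≤ |ξ| →
      |iteratedDeriv j (Φ τ) ξ| ≤ η ∧ |iteratedDeriv j (Ψ τ) ξ| ≤ η := by
  have key : ∀ j ∈ Finset.range 4, ∀ᶠ R in atTop, ∀ τ ∈ Icc 0 T, ∀ ξ : ℝ, R ≤ |ξ| →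
      |iteratedDeriv j (Φ τ) ξ| ≤ η ∧ |iteratedDeriv j (Ψ τ) ξ| ≤ η := by
    intro j hj
    rw [Finset.mem_range] at hj
    obtain ⟨R1, h1⟩ := h.decayΦ j (by omega) η hη
    obtain ⟨R2, h2⟩ := h.decayΨ j (by omega) η hη
    filter_upwards [eventually_ge_atTop R1, eventually_ge_atTop R2] with R hR1 hR2 τ hτ ξ hξ
    exact ⟨(h1 τ hτ ξ (hR1.trans hξ)).le, (h2 τ hτ ξ (hR2.trans hξ)).le⟩
  filter_upwards [(Finset.eventually_all _).2 key] with R hR j hj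
  exact hR j (Finset.mem_range.2 (by omega))

lemma integral_energyDensity_le (h : IsClassicalSolution p g tv s T Φ Ψ) {τ A0 A1 A2 M R : ℝ}
    {w : ℝ → ℝ} (hτ : τ ∈ Icc 0 T) (hA0 : 0 < A0) (hA1 : 0 < A1) (hA2 : 0 < A2) (hM : 1 ≤ M)
    (hw : ∀ ξ, w ξ ≤ M) (hwc : Continuous w) (hR : 0 ≤ R) :
    ∫ ξ in -R..R, energyDensity A0 A1 A2 (w ξ) (iteratedDeriv 0 (Φ τ) ξ)
        (iteratedDeriv 1 (Φ τ) ξ) (iteratedDeriv 2 (Φ τ) ξ) (iteratedDeriv 0 (Ψ τ) ξ)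
        (iteratedDeriv 1 (Ψ τ) ξ) (iteratedDeriv 2 (Ψ τ) ξ)
      ≤ (A0 + A1 + A2 + 1) * M * pairHkSq 2 (Φ τ) (Ψ τ) := by
  have cΦ : ∀ j ≤ 2, Continuous (iteratedDeriv j (Φ τ)) := fun j hj =>
    (h.regΦ τ hτ).continuous_iteratedDeriv j (by exact_mod_cast (by omega : j ≤ 4))
  have cΨ : ∀ j ≤ 2, Continuous (iteratedDeriv j (Ψ τ)) := fun j hj =>
    (h.regΨ τ hτ).continuous_iteratedDeriv j (by exact_mod_cast (by omega : j ≤ 4))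
  have iΦ : ∀ j ≤ 2, Integrable fun ξ => iteratedDeriv j (Φ τ) ξ ^ 2 := fun j hj =>
    h.sqIntΦ j (by omega) τ hτ
  have iΨ : ∀ j ≤ 2, Integrable fun ξ => iteratedDeriv j (Ψ τ) ξ ^ 2 := fun j hj =>
    h.sqIntΨ j (by omega) τ hτ
  have I1 := (iΦ 0 (by norm_num)).fun_add (iΦ 1 (by norm_num))
  have I2 := I1.fun_add (iΦ 2 le_rfl)
  have I3 := I2.fun_add (iΨ 0 (by norm_num))
  have I4 := I3.fun_add (iΨ 1 (by norm_num))
  have I5 := I4.fun_add (iΨ 2 le_rfl)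
  have hsum : ∫ ξ, (iteratedDeriv 0 (Φ τ) ξ ^ 2 + iteratedDeriv 1 (Φ τ) ξ ^ 2
      + iteratedDeriv 2 (Φ τ) ξ ^ 2 + iteratedDeriv 0 (Ψ τ) ξ ^ 2 + iteratedDeriv 1 (Ψ τ) ξ ^ 2
      + iteratedDeriv 2 (Ψ τ) ξ ^ 2) = pairHkSq 2 (Φ τ) (Ψ τ) := by
    rw [integral_add I4 (iΨ 2 le_rfl), integral_add I3 (iΨ 1 (by norm_num)),
      integral_add I2 (iΨ 0 (by norm_num)), integral_add I1 (iΦ 2 le_rfl),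
      integral_add (iΦ 0 (by norm_num)) (iΦ 1 (by norm_num))]
    simp only [pairHkSq, HkSq, L2sq, Finset.sum_range_succ, Finset.sum_range_zero]
    ring
  have hneg : -R ≤ R := by linarith
  rw [← hsum, ← integral_const_mul]
  refine (intervalIntegral.integral_mono_on hneg
    ((continuous_energyDensity hwc (cΦ 0 (by norm_num)) (cΦ 1 (by norm_num)) (cΦ 2 le_rfl)
      (cΨ 0 (by norm_num)) (cΨ 1 (by norm_num)) (cΨ 2 le_rfl)).intervalIntegrable _ _)
    (I5.const_mul ((A0 + A1 + A2 + 1) * M)).intervalIntegrable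
    fun ξ _ => energyDensity_le hA0 hA1 hA2 hM (hw ξ)).trans ?_
  rw [intervalIntegral.integral_of_le hneg]
  exact setIntegral_le_integral (I5.const_mul ((A0 + A1 + A2 + 1) * M))
    (Eventually.of_forall fun ξ => by
      simp only [Pi.zero_apply]
      positivity)

/-- Exhausting the line by the intervals `[-R, R]` in the space-time integral of `Ψ_ξξ²`. -/
lemma tendsto_integral_Psi (h : IsClassicalSolution p g tv s T Φ Ψ) {t : ℝ} (ht : t ∈ Icc 0 T) :
    Tendsto (fun R => ∫ τ in 0..t, ∫ ξ in -R..R, iteratedDeriv 2 (Ψ τ) ξ ^ 2 / 2) atTop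
      (𝓝 (∫ τ in 0..t, L2sq (iteratedDeriv 2 (Ψ τ)) / 2)) := by
  have hsub : ∀ {τ}, τ ∈ uIoc 0 t → τ ∈ Icc 0 T := fun {τ} hτ => by
    rw [uIoc_of_le ht.1] at hτ
    exact ⟨hτ.1.le, hτ.2.trans ht.2⟩
  have hint : ∀ τ ∈ Icc 0 T, Integrable fun ξ => iteratedDeriv 2 (Ψ τ) ξ ^ 2 / 2 := fun τ hτ =>
    (h.sqIntΨ 2 (by norm_num) τ hτ).div_const 2
  have hval : ∀ τ, ∫ ξ, iteratedDeriv 2 (Ψ τ) ξ ^ 2 / 2 = L2sq (iteratedDeriv 2 (Ψ τ)) / 2 :=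
    fun τ => integral_div _ _
  have hc : ContinuousOn (fun q : ℝ × ℝ => iteratedDeriv 2 (Ψ q.1) q.2 ^ 2 / 2)
      (Icc 0 T ×ˢ univ) := ((h.spContΨ 2 (by norm_num)).pow 2).div_const 2
  refine intervalIntegral.tendsto_integral_filter_of_dominated_convergence
    (fun τ => L2sq (iteratedDeriv 2 (Ψ τ)) / 2) ?_ ?_ ?_ ?_
  · filter_upwards [eventually_ge_atTop 0] with R hR
    have := intervalIntegrable_integral (F := fun τ ξ => iteratedDeriv 2 (Ψ τ) ξ ^ 2 / 2) hc ht hR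
    exact (intervalIntegrable_iff.1 this).aestronglyMeasurable
  · filter_upwards [eventually_ge_atTop 0] with R hR
    refine Eventually.of_forall fun τ hτ => ?_
    have hneg : -R ≤ R := by linarith
    rw [Real.norm_eq_abs, abs_of_nonneg
      (intervalIntegral.integral_nonneg hneg fun ξ _ => by positivity), ← hval,
      intervalIntegral.integral_of_le hneg]
    exact setIntegral_le_integral (hint τ (hsub hτ)) (Eventually.of_forall fun ξ => by positivity)
  · refine ((h.l2ContΨ 2 (by norm_num)).div_const 2).mono ?_ |>.intervalIntegrable
    rw [uIcc_of_le ht.1]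
    exact Icc_subset_Icc_right ht.2
  · refine Eventually.of_forall fun τ hτ => ?_
    rw [← hval]
    exact intervalIntegral_tendsto_integral (hint τ (hsub hτ)) tendsto_neg_atTop_atBot tendsto_id

end IsClassicalSolution

/-- The dissipation estimate, for solutions that stay within the smallness threshold `d`. -/
lemma integral_L2sq_Psi_le {p g tv : ℝ → ℝ} {s c M r d A0 A1 A2 T t : ℝ} {Φ Ψ : ℝ → ℝ → ℝ}
    (hB : CoeffBounds p g tv s c M r) (hd1 : d ≤ 1) (hdr : d ≤ r)
    (hA0 : 0 < A0) (hA1 : 1 ≤ A1) (hA2 : 1 ≤ c * A2)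
    (hA : ∀ x y z h X0 X1 X2 X3 : ℝ,
        X0 ≤ -c * x ^ 2 + 2 * M ^ 3 * d * x ^ 2 →
        X1 ≤ -c * y ^ 2 + 2 * M ^ 3 * (x * y) + 2 * M ^ 3 * x ^ 2 →
        X2 ≤ -c * z ^ 2 + 2 * M ^ 3 * (z * (x + y)) + 2 * M ^ 3 * (h * (x + y))
          + 2 * M ^ 3 * d * (h * z) →
        X3 ≤ -h ^ 2 + 2 * M ^ 3 * (h * (x + y + z)) + 2 * M ^ 3 * (x * (x + y + z)) →
        0 ≤ h → 0 ≤ z →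
        A0 * X0 + A1 * X1 + A2 * X2 + X3 ≤ -h ^ 2 / 2)
    (h : IsClassicalSolution p g tv s T Φ Ψ)
    (hsmall : ∀ τ ∈ Icc 0 T, √(pairHkSq 3 (Φ τ) (Ψ τ)) ≤ d) (ht : t ∈ Icc 0 T) :
    ∫ τ in 0..t, L2sq (iteratedDeriv 2 (Ψ τ))
      ≤ 2 * ((A0 + A1 + A2 + 1) * M) * pairHkSq 2 (Φ 0) (Ψ 0) := by
  have hA1p : 0 < A1 := by linarith
  have hA2p : 0 < A2 := pos_of_mul_pos_right (by linarith) hB.c_pos.le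
  have hM : 1 ≤ M := hB.incr_p.one_le
  have h0T : (0 : ℝ) ∈ Icc 0 T := ⟨le_rfl, ht.1.trans ht.2⟩
  have hwc : Continuous (symWeight p tv) :=
    continuous_iff_continuousAt.2 fun ξ => (hB.hasDerivAt_weight ξ).continuousAt
  have cΦ : ∀ j ≤ 2, ∀ τ ∈ Icc 0 T, Continuous (iteratedDeriv j (Φ τ)) := fun j hj τ hτ =>
    (h.regΦ τ hτ).continuous_iteratedDeriv j (by exact_mod_cast (by omega : j ≤ 4))
  have cΨ : ∀ j ≤ 2, ∀ τ ∈ Icc 0 T, Continuous (iteratedDeriv j (Ψ τ)) := fun j hj τ hτ =>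
    (h.regΨ τ hτ).continuous_iteratedDeriv j (by exact_mod_cast (by omega : j ≤ 4))
  obtain ⟨e, he⟩ : ∃ e : ℝ → ℝ → ℝ, e = fun τ ξ => energyDensity A0 A1 A2 (symWeight p tv ξ)
      (iteratedDeriv 0 (Φ τ) ξ) (iteratedDeriv 1 (Φ τ) ξ) (iteratedDeriv 2 (Φ τ) ξ)
      (iteratedDeriv 0 (Ψ τ) ξ) (iteratedDeriv 1 (Ψ τ) ξ) (iteratedDeriv 2 (Ψ τ) ξ) := ⟨_, rfl⟩
  obtain ⟨et, het⟩ : ∃ et : ℝ → ℝ → ℝ, et = fun τ ξ => energyRate A0 A1 A2 (symWeight p tv ξ)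
      (iteratedDeriv 0 (Φ τ) ξ) (iteratedDeriv 1 (Φ τ) ξ) (iteratedDeriv 2 (Φ τ) ξ)
      (iteratedDeriv 0 (Ψ τ) ξ) (iteratedDeriv 1 (Ψ τ) ξ) (iteratedDeriv 2 (Ψ τ) ξ)
      (deriv (fun σ => iteratedDeriv 0 (Φ σ) ξ) τ) (deriv (fun σ => iteratedDeriv 1 (Φ σ) ξ) τ)
      (deriv (fun σ => iteratedDeriv 2 (Φ σ) ξ) τ) (deriv (fun σ => iteratedDeriv 0 (Ψ σ) ξ) τ)
      (deriv (fun σ => iteratedDeriv 1 (Ψ σ) ξ) τ) (deriv (fun σ => iteratedDeriv 2 (Ψ σ) ξ) τ) :=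
    ⟨_, rfl⟩
  have hec : ∀ τ ∈ Icc 0 T, Continuous (e τ) := fun τ hτ => by
    rw [he]
    exact continuous_energyDensity hwc (cΦ 0 (by norm_num) τ hτ) (cΦ 1 (by norm_num) τ hτ)
      (cΦ 2 le_rfl τ hτ) (cΨ 0 (by norm_num) τ hτ) (cΨ 1 (by norm_num) τ hτ) (cΨ 2 le_rfl τ hτ)
  have hde : ∀ τ ∈ Icc 0 T, ∀ ξ, HasDerivAt (fun σ => e σ ξ) (et τ ξ) τ := fun τ hτ ξ => by
    rw [he, het]
    exact hasDerivAt_energyDensity (h.tdiffΦ 0 (by norm_num) τ hτ ξ).hasDerivAt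
      (h.tdiffΦ 1 (by norm_num) τ hτ ξ).hasDerivAt (h.tdiffΦ 2 (by norm_num) τ hτ ξ).hasDerivAt
      (h.tdiffΨ 0 (by norm_num) τ hτ ξ).hasDerivAt (h.tdiffΨ 1 (by norm_num) τ hτ ξ).hasDerivAt
      (h.tdiffΨ 2 (by norm_num) τ hτ ξ).hasDerivAt
  have hetc : ContinuousOn (fun q : ℝ × ℝ => et q.1 q.2) (Icc 0 T ×ˢ univ) := by
    rw [het]
    exact continuousOn_energyRate (hwc.comp continuous_snd).continuousOn
      (h.spContΦ 0 (by norm_num)) (h.spContΦ 1 (by norm_num)) (h.spContΦ 2 (by norm_num))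
      (h.spContΨ 0 (by norm_num)) (h.spContΨ 1 (by norm_num)) (h.spContΨ 2 (by norm_num))
      (h.mixContΦ 0 (by norm_num)) (h.mixContΦ 1 (by norm_num)) (h.mixContΦ 2 (by norm_num))
      (h.mixContΨ 0 (by norm_num)) (h.mixContΨ 1 (by norm_num)) (h.mixContΨ 2 (by norm_num))
  have hD : ContinuousOn (fun q : ℝ × ℝ => iteratedDeriv 2 (Ψ q.1) q.2 ^ 2 / 2)
      (Icc 0 T ×ˢ univ) := ((h.spContΨ 2 (by norm_num)).pow 2).div_const 2
  set K := 2 * ((A0 + A1 + A2 + 1) * (6 * M ^ 2)) with hK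
  have hKp : 0 < K := by positivity
  have main : ∀ ε > 0, ∫ τ in 0..t, L2sq (iteratedDeriv 2 (Ψ τ)) / 2
      ≤ (A0 + A1 + A2 + 1) * M * pairHkSq 2 (Φ 0) (Ψ 0) + ε * t := by
    intro ε hε
    have hη : 0 < min 1 (ε / K) := lt_min one_pos (by positivity)
    have hKη : K * min 1 (ε / K) ≤ ε := by
      calc K * min 1 (ε / K) ≤ K * (ε / K) := by gcongr; exact min_le_right _ _
        _ = ε := by field_simp
    refine le_of_tendsto (h.tendsto_integral_Psi ht) ?_
    filter_upwards [h.eventually_abs_le hη, eventually_ge_atTop 0] with R hend hR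
    refine (integral_dissipation_le (e := e) (et := et)
      (D := fun τ ξ => iteratedDeriv 2 (Ψ τ) ξ ^ 2 / 2) (ε := ε) ht hR (fun ξ => ?_) (hec 0 h0T)
      (hec t ht) hde hetc hD fun τ hτ => ?_).trans ?_
    · rw [he]
      exact energyDensity_nonneg hA0 hA1 hB.c_pos hA2 (hB.le_weight ξ)
    · have hI := Ioo_subset_Icc_self hτ
      have hsup : ∀ j ≤ 2, ∀ ξ, _ := fun j hj ξ => h.abs_le_of_sqrt_le hI (hsmall τ hI) hj ξ
      have hcont : Continuous (et τ) :=
        hetc.comp_continuous (Continuous.prodMk_right τ) fun ξ => ⟨hI, mem_univ ξ⟩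
      rw [het] at hcont ⊢
      exact ((h.isSlice hτ).integral_energyRate_le hB hd1 hdr hA0 hA1p hA2p hA
        (fun ξ => (hsup 1 (by norm_num) ξ).1) (fun ξ => (hsup 2 le_rfl ξ).1)
        (fun ξ => (hsup 0 (by norm_num) ξ).2) (fun ξ => (hsup 1 (by norm_num) ξ).2)
        hR (min_le_left _ _) hcont fun ξ hξ => ⟨(hend 0 (by norm_num) τ hI ξ hξ).1,
          (hend 1 (by norm_num) τ hI ξ hξ).1, (hend 2 (by norm_num) τ hI ξ hξ).1,
          (hend 3 le_rfl τ hI ξ hξ).1, (hend 0 (by norm_num) τ hI ξ hξ).2,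
          (hend 1 (by norm_num) τ hI ξ hξ).2, (hend 2 (by norm_num) τ hI ξ hξ).2⟩).trans hKη
    · rw [he]
      gcongr
      exact h.integral_energyDensity_le h0T hA0 hA1p hA2p hM hB.weight_le hwc hR
  have hlim : ∫ τ in 0..t, L2sq (iteratedDeriv 2 (Ψ τ)) / 2
      ≤ (A0 + A1 + A2 + 1) * M * pairHkSq 2 (Φ 0) (Ψ 0) := by
    refine le_of_forall_pos_le_add fun ε hε => ?_
    have ht0 := ht.1
    refine (main (ε / (t + 1)) (by positivity)).trans ?_
    gcongr
    rw [div_mul_eq_mul_div, div_le_iff₀ (by positivity)]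
    nlinarith
  rw [intervalIntegral.integral_div] at hlim
  linarith

theorem psi_xixi_estimate
    (p : ℝ → ℝ)
    (hp_smooth : ContDiffOn ℝ (⊤ : ℕ∞) p (Set.Ioi 0))
    (hpd : ∀ v ∈ Set.Ioi (0:ℝ), deriv p v < 0)
    (hpdd : ∀ v ∈ Set.Ioi (0:ℝ), 0 ≤ deriv (deriv p) v)
    (hpdd_ne : ∀ a b : ℝ, 0 < a → a < b → ∃ v ∈ Set.Ioo a b, deriv (deriv p) v ≠ 0)
    (μ : ℝ → ℝ)
    (hmu_smooth : ContDiffOn ℝ (⊤ : ℕ∞) μ (Set.Ioi 0))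
    (hmu_pos : ∀ v ∈ Set.Ioi (0:ℝ), 0 < μ v)
    (vp vm s : ℝ)
    (hvp : 0 < vp) (hvpvm : vp < vm)
    (hs : s = -Real.sqrt (-((p vp - p vm) / (vp - vm))))
    (hsneg : s < 0)
    (g : ℝ → ℝ)
    (hg : ∀ z ∈ Set.Ioi (0:ℝ), HasDerivAt g (μ z / z) z)
    (tv : ℝ → ℝ)
    (htv_smooth : ContDiff ℝ (⊤ : ℕ∞) tv)
    (htv_ode : ∀ ξ : ℝ, deriv tv ξ
        = tv ξ / (-s * μ (tv ξ)) * (s ^ 2 * (tv ξ - vm) + p (tv ξ) - p vm))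
    (htv_mem : ∀ ξ : ℝ, tv ξ ∈ Set.Ioo vp vm)
    (htv_dec : ∀ ξ : ℝ, deriv tv ξ < 0)
    (htv_bot : Filter.Tendsto tv Filter.atBot (nhds vm))
    (htv_top : Filter.Tendsto tv Filter.atTop (nhds vp))
    (htv_bdd : ∀ k : ℕ, ∃ M : ℝ, ∀ ξ : ℝ, |iteratedDeriv k tv ξ| ≤ M)
 :
    ∃ δ₀ > (0:ℝ), ∃ C > (0:ℝ), ∀ T > (0:ℝ), ∀ δ ≤ δ₀, ∀ Φ Ψ : ℝ → ℝ → ℝ,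
      IsClassicalSolution p g tv s T Φ Ψ →
      (∀ t ∈ Set.Icc (0:ℝ) T, Real.sqrt (pairHkSq 3 (Φ t) (Ψ t)) ≤ δ) →
      ∀ t ∈ Set.Icc (0:ℝ) T,
        (∫ τ in (0:ℝ)..t, L2sq (iteratedDeriv 2 (Ψ τ))) ≤ C * pairHkSq 2 (Φ 0) (Ψ 0) := by
  obtain ⟨c, M, hB⟩ := exists_coeffBounds hp_smooth hpd hpdd hmu_smooth hmu_pos hvp hsneg hg
    htv_smooth htv_mem htv_dec htv_bdd
  have hM : 1 ≤ M := hB.incr_p.one_le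
  have hM3 : 1 ≤ 2 * M ^ 3 := by
    have : 1 ≤ M ^ 3 := one_le_pow₀ hM
    linarith
  obtain ⟨A0, A1, A2, d0, hA0, hA1, hA2, hd0, hA⟩ := exists_energy_weights hB.c_pos hM3
  have hA2p : 0 < A2 := pos_of_mul_pos_right (by linarith) hB.c_pos.le
  have hδ : 0 < min d0 (min 1 (vp / 2)) := lt_min hd0 (lt_min one_pos (by linarith))
  refine ⟨min d0 (min 1 (vp / 2)), hδ, 2 * ((A0 + A1 + A2 + 1) * M), by positivity, ?_⟩
  intro T _ δ hδ₀ Φ Ψ h hsmall t ht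
  exact integral_L2sq_Psi_le hB ((min_le_right _ _).trans (min_le_left _ _))
    ((min_le_right _ _).trans (min_le_right _ _)) hA0 hA1 hA2 (hA _ hδ.le (min_le_left _ _)) h
    (fun τ hτ => (hsmall τ hτ).trans hδ₀) ht
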